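/- arXiv:1702.06419 — 3 statements merged into one kernel-verified Lean document; each statement's English description precedes it below -/
import Mathlib

section
/- Let p be a prime and A ⊆ F_p with A ∩ (-A) = ∅. Then |Σ(A)| ≥ min{p, |A|(|A|+1)/2 + 1}, where Σ(A) is the set of all subset sums of A (including the empty sum 0). -/
/-- The (unsigned) coefficients of the Bessel polynomials. -/
def besselCoeff : ℕ → ℕ → ℕ
  | _, 0 => 1
  | 0, _ + 1 => 0
  | d + 1, k + 1 => besselCoeff d (k + 1) + (d + k + 1) * besselCoeff d k

theorem besselCoeff_zero_right (d : ℕ) : besselCoeff d 0 = 1 := by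
  cases d <;> rfl

theorem besselCoeff_eq_zero_of_lt {d k : ℕ} (h : d < k) : besselCoeff d k = 0 := by
  induction d generalizing k with
  | zero => obtain ⟨k, rfl⟩ := Nat.exists_eq_succ_of_ne_zero h.ne'; rfl
  | succ d ih =>
    obtain ⟨k, rfl⟩ := Nat.exists_eq_succ_of_ne_zero (by omega : k ≠ 0)
    simp [besselCoeff, ih (by omega : d < k + 1), ih (by omega : d < k)]

theorem besselCoeff_mul_factorial {d k : ℕ} (h : k ≤ d) :
    besselCoeff d k * (2 ^ k * k.factorial * (d - k).factorial) = (d + k).factorial := by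
  induction d generalizing k with
  | zero => obtain rfl : k = 0 := by omega
            rfl
  | succ d ih =>
    cases k with
    | zero => simp [besselCoeff]
    | succ k =>
      have h₂ := ih (by omega : k ≤ d)
      rcases (by omega : k = d ∨ k + 1 ≤ d) with rfl | hk
      · rw [besselCoeff, besselCoeff_eq_zero_of_lt (Nat.lt_succ_self k), Nat.add_sub_add_right,
          show k + 1 + (k + 1) = k + k + 1 + 1 by ring, Nat.factorial_succ (k + k + 1),
          Nat.factorial_succ (k + k), ← h₂, Nat.factorial_succ k]
        ring
      · have h₁ := ih hk
        obtain ⟨m, rfl⟩ := Nat.exists_eq_add_of_le hk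
        rw [show k + 1 + m - (k + 1) = m by omega,
          show k + 1 + m + (k + 1) = k + 1 + m + k + 1 by ring,
          Nat.factorial_succ (k + 1 + m + k)] at h₁
        rw [show k + 1 + m - k = m + 1 by omega] at h₂
        rw [besselCoeff, Nat.add_sub_add_right, show k + 1 + m - k = m + 1 by omega,
          show k + 1 + m + 1 + (k + 1) = k + 1 + m + k + 1 + 1 by ring,
          Nat.factorial_succ (k + 1 + m + k + 1),
          Nat.factorial_succ (k + 1 + m + k)]
        rw [Nat.factorial_succ m] at h₂ ⊢
        rw [Nat.factorial_succ k] at h₁ ⊢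
        linear_combination (m + 1) * h₁ + 2 * (k + 1 + m + k + 1) * (k + 1) * h₂

theorem prod_sub_odd_eq_sum_descPochhammer {R : Type*} [CommRing R] (d : ℕ) (x : R) :
    ∏ i ∈ Finset.range d, (x - (2 * i + 1)) =
      ∑ k ∈ Finset.range (d + 1),
        (-1) ^ k * (besselCoeff d k : R) * (descPochhammer R (d - k)).eval x := by
  induction d with
  | zero => simp [besselCoeff]
  | succ d ih =>
    rw [Finset.prod_range_succ, ih, Finset.sum_range_succ' _ (d + 1), Finset.sum_mul]
    have hstep : ∀ k ∈ Finset.range (d + 1),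
        (-1) ^ k * (besselCoeff d k : R) * (descPochhammer R (d - k)).eval x * (x - (2 * d + 1)) =
        (-1) ^ k * (besselCoeff d k : R) * (descPochhammer R (d + 1 - k)).eval x +
        (-1) ^ (k + 1) * ((d + k + 1 : ℕ) * besselCoeff d k : R) *
          (descPochhammer R (d - k)).eval x := by
      intro k hk
      have hk' : k ≤ d := by simpa [Nat.lt_succ_iff] using hk
      rw [show d + 1 - k = (d - k) + 1 by omega, descPochhammer_succ_eval, Nat.cast_sub hk']
      push_cast
      ring
    rw [Finset.sum_congr rfl hstep, Finset.sum_add_distrib,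
      Finset.sum_range_succ' (fun k ↦ (-1) ^ k * (besselCoeff d k : R) *
        (descPochhammer R (d + 1 - k)).eval x), add_right_comm]
    congr 1
    · simp only [besselCoeff, Nat.add_sub_add_right, Nat.cast_add (besselCoeff d _), Nat.cast_mul,
        mul_add ((-1 : R) ^ _), add_mul _ _ (Polynomial.eval _ _), Finset.sum_add_distrib]
      congr 1
      rw [Finset.sum_range_succ]
      simp [besselCoeff_eq_zero_of_lt (Nat.lt_succ_self d)]
    · simp [besselCoeff_zero_right]

/-- The exponents `0, …, d - 1`, with `d - t` replaced by `d` when `t ≠ 0`. -/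
def gapExponent (d t : ℕ) (j : Fin d) : ℕ := if j + t = d then d else j

theorem sum_gapExponent {d t : ℕ} (ht : t ≤ d) :
    2 * ∑ j, gapExponent d t j + d = d ^ 2 + 2 * t := by
  have h : ∀ j : Fin d, gapExponent d t j = j + if (j : ℕ) = d - t then t else 0 := by
    intro j
    unfold gapExponent
    split_ifs <;> omega
  have h1 := Finset.sum_range_id_mul_two d
  have h2 : d * (d - 1) + d = d ^ 2 := by cases d <;> simp; ring
  simp only [h, Finset.sum_add_distrib, Fin.sum_univ_eq_sum_range (fun j ↦ j),
    Fin.sum_univ_eq_sum_range (fun j ↦ if j = d - t then t else 0), Finset.sum_ite_eq',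
    Finset.mem_range]
  split_ifs <;> omega

theorem det_descPochhammer_gapExponent_ne_zero {p : ℕ} [Fact p.Prime] {d t : ℕ}
    (hd : 2 * d < p) (ht : t ≤ d) :
    (Matrix.of fun i j : Fin d ↦
      (descPochhammer (ZMod p) (gapExponent d t j)).eval ((2 * i + 1 : ℕ) : ZMod p)).det ≠ 0 := by
  have hp := (Fact.out : p.Prime)
  set M : Matrix (Fin d) (Fin d) (ZMod p) := Matrix.of fun i j : Fin d ↦
      (descPochhammer (ZMod p) (j : ℕ)).eval ((2 * i + 1 : ℕ) : ZMod p) with hM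
  have hM0 : M.det ≠ 0 := by
    rw [hM, ← Matrix.det_eval_matrixOfPolynomials_eq_det_vandermonde
      (fun i : Fin d ↦ ((2 * i + 1 : ℕ) : ZMod p)) (fun j ↦ descPochhammer (ZMod p) j)
      (fun j ↦ descPochhammer_natDegree _ _) (fun j ↦ monic_descPochhammer _ _),
      Matrix.det_vandermonde_ne_zero_iff]
    intro i j hij
    have h := (ZMod.natCast_eq_natCast_iff' _ _ _).1 hij
    rw [Nat.mod_eq_of_lt (by omega), Nat.mod_eq_of_lt (by omega)] at h
    exact Fin.ext (by omega)
  rcases Nat.eq_zero_or_pos t with rfl | ht0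
  · convert hM0 using 5 with i j
    simp [gapExponent, j.2.ne]
  · let h : Fin d := ⟨d - t, by omega⟩
    let c : Fin d → ZMod p := fun j ↦ -((-1) ^ (d - j : ℕ) * (besselCoeff d (d - j) : ZMod p))
    have hcol : (Matrix.of fun i j : Fin d ↦
        (descPochhammer (ZMod p) (gapExponent d t j)).eval ((2 * i + 1 : ℕ) : ZMod p)) =
        M.updateCol h (fun i ↦ ∑ j, c j • M i j) := by
      ext i j
      rw [Matrix.updateCol_apply]
      split_ifs with hj
      · have hg : gapExponent d t j = d := by
          simp [hj, h, gapExponent, Nat.sub_add_cancel ht]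
        have hz := prod_sub_odd_eq_sum_descPochhammer d (((2 * i + 1 : ℕ) : ZMod p))
        rw [Finset.prod_eq_zero (Finset.mem_range.2 i.2) (by push_cast; ring),
          ← Finset.sum_range_reflect, Finset.sum_range_succ] at hz
        rw [Matrix.of_apply, hg, ← sub_eq_zero, eq_comm, hz, ← Fin.sum_univ_eq_sum_range (fun j ↦
          (-1 : ZMod p) ^ (d + 1 - 1 - j) * (besselCoeff d (d + 1 - 1 - j) : ZMod p) *
            (descPochhammer (ZMod p) (d - (d + 1 - 1 - j))).eval ((2 * i + 1 : ℕ) : ZMod p)) d]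
        simp only [c, hM, Matrix.of_apply, smul_eq_mul, neg_mul, Finset.sum_neg_distrib]
        rw [sub_neg_eq_add, add_comm]
        congr 1
        · simp [besselCoeff_zero_right]
        · refine Finset.sum_congr rfl fun k _ ↦ ?_
          rw [show d - (d + 1 - 1 - k) = (k : ℕ) by omega, Nat.add_sub_cancel]
      · have hg : gapExponent d t j = j := by
          have : (j : ℕ) ≠ d - t := fun e ↦ hj (Fin.ext e)
          simp only [gapExponent]
          rw [if_neg (by omega)]
        simp [hM, hg]
    rw [hcol, Matrix.det_updateCol_sum, smul_eq_mul]
    refine mul_ne_zero ?_ hM0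
    have hb : (besselCoeff d t : ZMod p) ≠ 0 := by
      intro h0
      rw [ZMod.natCast_eq_zero_iff] at h0
      have hdvd := besselCoeff_mul_factorial ht ▸ h0.mul_right _
      exact absurd ((hp.dvd_factorial).1 hdvd) (by omega)
    have e : d - (d - t) = t := by omega
    simp only [c, h, e]
    simpa using hb

theorem sum_units_int_pow_succ {R : Type*} [CommRing R] (k : ℕ) :
    ∑ u : ℤˣ, ((u : ℤ) : R) * ((u : ℤ) : R) ^ k = if Odd k then 2 else 0 := by
  rw [show (Finset.univ : Finset ℤˣ) = {1, -1} from rfl, Finset.sum_pair (by decide)]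
  split_ifs with h
  · simp [h.neg_one_pow]; norm_num
  · simp [(Nat.not_odd_iff_even.1 h).neg_one_pow]

theorem sum_sign_mul_eval {R : Type*} [CommRing R] {d : ℕ} (a : Fin d → R)
    (P : MvPolynomial (Fin d) R) :
    ∑ ε : Fin d → ℤˣ, (∏ i, ((ε i : ℤ) : R)) * MvPolynomial.eval (fun i ↦ ((ε i : ℤ) : R) * a i) P =
      ∑ e ∈ P.support, if ∀ i, Odd (e i) then 2 ^ d * (P.coeff e * ∏ i, a i ^ e i) else 0 := by
  simp only [MvPolynomial.eval_eq', Finset.mul_sum]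
  rw [Finset.sum_comm]
  refine Finset.sum_congr rfl fun e _ ↦ ?_
  have h : ∀ ε : Fin d → ℤˣ, (∏ i, ((ε i : ℤ) : R)) *
      (P.coeff e * ∏ i, (((ε i : ℤ) : R) * a i) ^ e i) =
      (P.coeff e * ∏ i, a i ^ e i) * ∏ i, (((ε i : ℤ) : R) * ((ε i : ℤ) : R) ^ e i) := by
    intro ε
    simp only [mul_pow, Finset.prod_mul_distrib]
    ring
  rw [Finset.sum_congr rfl fun ε _ ↦ h ε, ← Finset.mul_sum, ← Fintype.piFinset_univ,
    ← Finset.prod_univ_sum (fun _ ↦ Finset.univ) fun i (u : ℤˣ) ↦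
      ((u : ℤ) : R) * ((u : ℤ) : R) ^ e i]
  simp only [sum_units_int_pow_succ]
  split_ifs with ho
  · simp [ho, mul_comm]
  · push Not at ho
    obtain ⟨i, hi⟩ := ho
    rw [Finset.prod_eq_zero (i := i) (f := fun i ↦ if Odd (e i) then (2 : R) else 0)
      (Finset.mem_univ i) (if_neg hi), mul_zero]

theorem exists_perm_of_injective_of_sum_le {d : ℕ} {f : Fin d → ℕ} (hf : Function.Injective f)
    (hs : ∑ i, f i ≤ ∑ i : Fin d, (i : ℕ)) : ∃ τ : Equiv.Perm (Fin d), ∀ i, f i = τ i := by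
  have hcard : (Finset.univ.image f).card = d := by
    rw [Finset.card_image_of_injective _ hf, Finset.card_univ, Fintype.card_fin]
  set g := (Finset.univ.image f).orderEmbOfFin hcard
  have hle : ∀ i : Fin d, (i : ℕ) ≤ g i := by
    rintro ⟨i, hi⟩
    induction i with
    | zero => exact Nat.zero_le _
    | succ i ih =>
      have hlt : g ⟨i, by omega⟩ < g ⟨i + 1, hi⟩ :=
        g.strictMono (Fin.mk_lt_mk.2 (Nat.lt_succ_self i))
      exact (ih (by omega)).trans_lt hlt
  have himg : Finset.univ.image g = Finset.univ.image f := Finset.image_orderEmbOfFin_univ _ hcard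
  have hsum : ∑ i, g i = ∑ i, f i := by
    rw [← Finset.sum_image (f := fun x ↦ x) (fun _ _ _ _ h ↦ g.injective h), himg,
      Finset.sum_image (fun _ _ _ _ h ↦ hf h)]
  have heq := (Finset.sum_eq_sum_iff_of_le fun i _ ↦ hle i).1
    (le_antisymm (Finset.sum_le_sum fun i _ ↦ hle i) (hsum.trans_le hs))
  have hlt : ∀ i, f i < d := by
    intro i
    obtain ⟨j, -, hj⟩ := Finset.mem_image.1
      (himg.symm ▸ Finset.mem_image_of_mem f (Finset.mem_univ i))
    rw [← hj, ← heq j (Finset.mem_univ j)]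
    exact j.2
  refine ⟨Equiv.ofBijective (fun i ↦ ⟨f i, hlt i⟩)
    (Finite.injective_iff_bijective.1 fun i j h ↦ hf (Fin.mk.inj h)), fun i ↦ rfl⟩

theorem sum_two_mul_add_one (d : ℕ) : ∑ i : Fin d, (2 * (i : ℕ) + 1) = d ^ 2 := by
  rw [Fin.sum_univ_eq_sum_range (fun i ↦ 2 * i + 1)]
  induction d with
  | zero => simp
  | succ d ih => rw [Finset.sum_range_succ, ih]; ring

theorem exists_perm_of_injective_of_odd {d : ℕ} {e : Fin d → ℕ} (he : Function.Injective e)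
    (ho : ∀ i, Odd (e i)) (hs : ∑ i, e i ≤ d ^ 2) :
    ∃ τ : Equiv.Perm (Fin d), ∀ i, e i = 2 * τ i + 1 := by
  choose f hf using ho
  obtain ⟨τ, hτ⟩ := exists_perm_of_injective_of_sum_le (f := f)
    (fun i j h ↦ he (by rw [hf, hf, h])) (by
      rw [← sum_two_mul_add_one] at hs
      simp only [hf, Finset.sum_add_distrib, ← Finset.mul_sum] at hs
      omega)
  exact ⟨τ, fun i ↦ by rw [hf, hτ]⟩

/-- The exponent vector `(1, 3, …, 2 d - 1)`. -/
noncomputable def oddExponent (d : ℕ) : Fin d →₀ ℕ :=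
  Finsupp.equivFunOnFinite.symm fun i ↦ 2 * i + 1

@[simp] theorem oddExponent_apply {d : ℕ} (i : Fin d) : oddExponent d i = 2 * i + 1 := rfl

theorem sum_sign_mul_eval_of_alternating {F : Type*} [Field F] (h2 : (2 : F) ≠ 0) {d N : ℕ}
    (a : Fin d → F) {P : MvPolynomial (Fin d) F} (hP : P.IsHomogeneous N) (hN : N ≤ d ^ 2)
    (halt : ∀ τ : Equiv.Perm (Fin d),
      MvPolynomial.rename τ P = MvPolynomial.C (((Equiv.Perm.sign τ : ℤˣ) : ℤ) : F) * P) :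
    ∑ ε : Fin d → ℤˣ, (∏ i, ((ε i : ℤ) : F)) * MvPolynomial.eval (fun i ↦ ((ε i : ℤ) : F) * a i) P =
      2 ^ d * P.coeff (oddExponent d) * (Matrix.of fun i j : Fin d ↦ a i ^ (2 * (j : ℕ) + 1)).det := by
  have hcoeff : ∀ (τ : Equiv.Perm (Fin d)) (e : Fin d →₀ ℕ),
      P.coeff e = (((Equiv.Perm.sign τ : ℤˣ) : ℤ) : F) * P.coeff (e.mapDomain τ) := by
    intro τ e
    rw [← MvPolynomial.coeff_rename_mapDomain τ τ.injective P e, halt, MvPolynomial.coeff_C_mul]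
  have hinj : ∀ e, P.coeff e ≠ 0 → Function.Injective e := by
    intro e he i j hij
    by_contra hne
    have hmap : e.mapDomain (Equiv.swap i j) = e := by
      ext k
      rw [← Finsupp.equivMapDomain_eq_mapDomain, Finsupp.equivMapDomain_apply, Equiv.symm_swap]
      by_cases h1 : k = i
      · rw [h1, Equiv.swap_apply_left, hij]
      by_cases h2 : k = j
      · rw [h2, Equiv.swap_apply_right, hij]
      rw [Equiv.swap_apply_of_ne_of_ne h1 h2]
    have h := hcoeff (Equiv.swap i j) e
    rw [hmap, Equiv.Perm.sign_swap hne] at h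
    have h' : (2 : F) * P.coeff e = 0 := by
      push_cast at h
      linear_combination h
    exact (mul_ne_zero h2 he) h'
  let E : Equiv.Perm (Fin d) → (Fin d →₀ ℕ) := fun τ ↦
    Finsupp.equivFunOnFinite.symm fun i ↦ 2 * τ i + 1
  have hE : ∀ τ i, E τ i = 2 * τ i + 1 := fun τ i ↦ rfl
  have hEinj : Function.Injective E := by
    intro σ τ h
    ext i
    have := DFunLike.congr_fun h i
    simp only [hE] at this
    omega
  have hcE : ∀ τ, P.coeff (E τ) = (((Equiv.Perm.sign τ : ℤˣ) : ℤ) : F) * P.coeff (oddExponent d) := by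
    intro τ
    rw [hcoeff τ (E τ)]
    congr 2
    ext i
    rw [← Finsupp.equivMapDomain_eq_mapDomain, Finsupp.equivMapDomain_apply, hE]
    simp
  rw [sum_sign_mul_eval, ← Matrix.det_transpose, Matrix.det_apply', Finset.mul_sum]
  rw [Finset.sum_subset (Finset.subset_union_left (s₂ := Finset.univ.image E))
    (by
      intro e _ he
      rw [MvPolynomial.notMem_support_iff.1 he]
      simp)]
  symm
  refine Finset.sum_of_injOn E hEinj.injOn
    (fun τ _ ↦ by simp) ?_ ?_
  · intro e _ he
    rw [ite_eq_right_iff]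
    intro ho
    by_cases hc : P.coeff e = 0
    · simp [hc]
    refine absurd ?_ he
    have hdeg : ∑ i, e i ≤ d ^ 2 := by
      have := hP.coeff_eq_zero (d := e)
      by_contra hlt
      refine hc (this ?_)
      rw [Finsupp.degree_eq_sum]
      omega
    obtain ⟨τ, hτ⟩ := exists_perm_of_injective_of_odd (hinj e hc) ho hdeg
    refine ⟨τ, by simp, ?_⟩
    ext i
    rw [hE, hτ]
  · intro τ _
    rw [if_pos (fun i ↦ by rw [hE]; exact odd_two_mul_add_one _), hcE]
    simp only [hE, Matrix.transpose_apply, Matrix.of_apply]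
    ring

theorem prod_factorial_mul_coeff_monomial_mul_sum_X_pow {R : Type*} [CommRing R] {d n : ℕ}
    (e m : Fin d →₀ ℕ) (h : ∑ i, m i + n = ∑ i, e i) :
    (∏ i, ((e i).factorial : R)) *
      MvPolynomial.coeff e (MvPolynomial.monomial m 1 * (∑ i, MvPolynomial.X i) ^ n) =
      n.factorial * ∏ i, ((e i).descFactorial (m i) : R) := by
  rw [MvPolynomial.coeff_monomial_mul', one_mul]
  split_ifs with hle
  · have hsub : ∑ i, (e - m) i = n := by
      have : ∑ i, (e - m) i + ∑ i, m i = ∑ i, e i := by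
        rw [← Finset.sum_add_distrib]
        exact Finset.sum_congr rfl fun i _ ↦ by simpa using Nat.sub_add_cancel (hle i)
      omega
    rw [MvPolynomial.coeff_sum_X_pow_of_fintype, Finsupp.sum_fintype _ _ (fun _ ↦ rfl), if_pos hsub,
      Finsupp.multinomial_eq_of_support_subset (Finset.subset_univ _)]
    have hspec := Nat.multinomial_spec Finset.univ (e - m)
    rw [hsub] at hspec
    rw [← hspec]
    have hfac : ∀ i, (e i).factorial = ((e - m) i).factorial * (e i).descFactorial (m i) := fun i ↦
      (Nat.factorial_mul_descFactorial (hle i)).symm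
    simp only [hfac]
    push_cast
    rw [Finset.prod_mul_distrib]
    ring
  · have : ∃ i, e i < m i := by
      by_contra! hcon
      exact hle hcon
    obtain ⟨i, hi⟩ := this
    rw [mul_zero, Finset.prod_eq_zero (Finset.mem_univ i), mul_zero]
    rw [Nat.descFactorial_eq_zero_iff_lt.2 hi, Nat.cast_zero]

/-- The product of the generalised Vandermonde determinant with exponents `μ` and the `n`-th power
of the sum of the variables. -/
noncomputable def alternantMulPow (R : Type*) [CommRing R] {d : ℕ} (μ : Fin d → ℕ) (n : ℕ) :
    MvPolynomial (Fin d) R :=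
  (Matrix.of fun i j : Fin d ↦ (MvPolynomial.X i : MvPolynomial (Fin d) R) ^ μ j).det *
    (∑ i, MvPolynomial.X i) ^ n

theorem alternantMulPow_isHomogeneous {R : Type*} [CommRing R] {d : ℕ} (μ : Fin d → ℕ) (n : ℕ) :
    (alternantMulPow R μ n).IsHomogeneous (∑ j, μ j + n) := by
  refine MvPolynomial.IsHomogeneous.mul ?_ ?_
  · rw [Matrix.det_apply']
    refine MvPolynomial.IsHomogeneous.sum _ _ _ fun σ _ ↦ ?_
    rw [← map_intCast (MvPolynomial.C (R := R) (σ := Fin d))]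
    exact (MvPolynomial.IsHomogeneous.prod _ _ _ fun i _ ↦
      MvPolynomial.isHomogeneous_X_pow _ _).C_mul _
  · have h : (∑ i : Fin d, (MvPolynomial.X i : MvPolynomial (Fin d) R)).IsHomogeneous 1 :=
      MvPolynomial.IsHomogeneous.sum _ _ _ fun i _ ↦ MvPolynomial.isHomogeneous_X _ _
    simpa using h.pow n

theorem rename_alternantMulPow {R : Type*} [CommRing R] {d : ℕ} (μ : Fin d → ℕ) (n : ℕ)
    (τ : Equiv.Perm (Fin d)) :
    MvPolynomial.rename τ (alternantMulPow R μ n) =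
      MvPolynomial.C (((Equiv.Perm.sign τ : ℤˣ) : ℤ) : R) * alternantMulPow R μ n := by
  unfold alternantMulPow
  set M := Matrix.of fun i j : Fin d ↦ (MvPolynomial.X i : MvPolynomial (Fin d) R) ^ μ j
  have hM : MvPolynomial.rename τ M.det = (M.submatrix τ id).det := by
    rw [AlgHom.map_det]
    congr 1
    ext1 i j
    simp [M]
  rw [map_mul, hM, Matrix.det_permute, map_pow, map_sum]
  simp only [MvPolynomial.rename_X]
  rw [Equiv.sum_comp τ (fun i ↦ (MvPolynomial.X i : MvPolynomial (Fin d) R)), mul_assoc, map_intCast]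

theorem prod_factorial_mul_coeff_alternantMulPow {R : Type*} [CommRing R] {d n : ℕ}
    (μ : Fin d → ℕ) (e : Fin d →₀ ℕ) (h : ∑ i, μ i + n = ∑ i, e i) :
    (∏ i, ((e i).factorial : R)) * (alternantMulPow R μ n).coeff e =
      n.factorial *
        (Matrix.of fun i j : Fin d ↦ (descPochhammer R (μ j)).eval ((e i : ℕ) : R)).det := by
  rw [alternantMulPow, ← Matrix.det_transpose, Matrix.det_apply, ← Matrix.det_transpose,
    Matrix.det_apply, Finset.sum_mul, MvPolynomial.coeff_sum, Finset.mul_sum, Finset.mul_sum]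
  refine Finset.sum_congr rfl fun σ _ ↦ ?_
  have hmon : ∏ i, (Matrix.of fun i j : Fin d ↦
      (MvPolynomial.X i : MvPolynomial (Fin d) R) ^ μ j).transpose (σ i) i =
      MvPolynomial.monomial (Finsupp.equivFunOnFinite.symm fun i ↦ μ (σ i)) 1 := by
    rw [MvPolynomial.monomial_eq, Finsupp.prod_fintype _ _ (by simp)]
    simp
  rw [hmon, Units.smul_def, Units.smul_def, smul_mul_assoc, MvPolynomial.coeff_smul,
    mul_smul_comm, prod_factorial_mul_coeff_monomial_mul_sum_X_pow, mul_smul_comm]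
  · simp [descPochhammer_eval_eq_descFactorial]
  · rw [← h, ← Equiv.sum_comp σ μ]
    simp

theorem card_signed_sums_gt {p : ℕ} [Fact p.Prime] {d n t : ℕ} (hd : 2 * d < p) (ht : t ≤ d)
    (hn : n < p) (hnt : 2 * (n + t) = d * (d + 1)) (a : Fin d → ZMod p) (ha0 : ∀ i, a i ≠ 0)
    (ha : ∀ i j, i ≠ j → a i ≠ a j ∧ a i ≠ -a j) :
    n < (Finset.univ.image fun ε : Fin d → ℤˣ ↦ ∑ i, ((ε i : ℤ) : ZMod p) * a i).card := by
  have hp := (Fact.out : p.Prime)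
  by_contra! hcard
  set S := Finset.univ.image fun ε : Fin d → ℤˣ ↦ ∑ i, ((ε i : ℤ) : ZMod p) * a i with hS
  rcases Nat.eq_zero_or_pos d with rfl | hd0
  · have : S.Nonempty := by simp [hS]
    have := this.card_pos
    omega
  have h2 : (2 : ZMod p) ≠ 0 := by
    intro h
    have := (ZMod.natCast_eq_zero_iff 2 p).1 (by exact_mod_cast h)
    have := Nat.le_of_dvd (by norm_num) this
    omega
  have hμ := sum_gapExponent ht
  have hdeg : ∑ j, gapExponent d t j + n = d ^ 2 := by nlinarith
  let Q : Polynomial (ZMod p) :=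
    (∏ s ∈ S, (Polynomial.X - Polynomial.C s)) * Polynomial.X ^ (n - S.card)
  have hQm : Q.Monic := (Polynomial.monic_prod_of_monic _ _ fun s _ ↦ Polynomial.monic_X_sub_C s).mul
    (Polynomial.monic_X_pow _)
  have hQd : Q.natDegree = n := by
    rw [(Polynomial.monic_prod_of_monic _ _ fun s _ ↦ Polynomial.monic_X_sub_C s).natDegree_mul
      (Polynomial.monic_X_pow _), Polynomial.natDegree_prod_of_monic _ _
      fun s _ ↦ Polynomial.monic_X_sub_C s]
    simp only [Polynomial.natDegree_X_sub_C, Polynomial.natDegree_X_pow, Finset.sum_const,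
      smul_eq_mul, mul_one]
    omega
  have hQ0 : ∀ ε : Fin d → ℤˣ, Q.eval (∑ i, ((ε i : ℤ) : ZMod p) * a i) = 0 := by
    intro ε
    rw [Polynomial.eval_mul, Polynomial.eval_prod, Finset.prod_eq_zero
      (Finset.mem_image_of_mem (fun ε : Fin d → ℤˣ ↦ ∑ i, ((ε i : ℤ) : ZMod p) * a i)
        (Finset.mem_univ ε)) (by
          rw [Polynomial.eval_sub, Polynomial.eval_X, Polynomial.eval_C, sub_self]), zero_mul]
  let D : Matrix (Fin d) (Fin d) (ZMod p) := Matrix.of fun i j : Fin d ↦ a i ^ (2 * (j : ℕ) + 1)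
  have hN : ∀ k ≤ n, ∑ ε : Fin d → ℤˣ, (∏ i, ((ε i : ℤ) : ZMod p)) *
      MvPolynomial.eval (fun i ↦ ((ε i : ℤ) : ZMod p) * a i)
        (alternantMulPow (ZMod p) (gapExponent d t) k) =
      2 ^ d * (alternantMulPow (ZMod p) (gapExponent d t) k).coeff (oddExponent d) * D.det :=
    fun k hk ↦ sum_sign_mul_eval_of_alternating h2 a (alternantMulPow_isHomogeneous _ _)
      (by omega) (rename_alternantMulPow _ _)
  have hNlt : ∀ k < n, (alternantMulPow (ZMod p) (gapExponent d t) k).coeff (oddExponent d) = 0 := by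
    intro k hk
    refine (alternantMulPow_isHomogeneous _ _).coeff_eq_zero ?_
    rw [Finsupp.degree_eq_sum]
    simp only [oddExponent_apply, sum_two_mul_add_one]
    omega
  have hsum : ∑ k ∈ Finset.range (n + 1), Q.coeff k *
      (2 ^ d * (alternantMulPow (ZMod p) (gapExponent d t) k).coeff (oddExponent d) * D.det) = 0 := by
    rw [Finset.sum_congr rfl fun k hk ↦ by
      rw [← hN k (Nat.lt_succ_iff.1 (Finset.mem_range.1 hk)), Finset.mul_sum], Finset.sum_comm]
    refine Finset.sum_eq_zero fun ε _ ↦ ?_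
    have hev := hQ0 ε
    rw [Polynomial.eval_eq_sum_range, hQd] at hev
    simp only [alternantMulPow, map_mul, map_pow, map_sum, MvPolynomial.eval_X]
    rw [← mul_zero ((∏ i, ((ε i : ℤ) : ZMod p)) * MvPolynomial.eval
      (fun i ↦ ((ε i : ℤ) : ZMod p) * a i) (Matrix.of fun i j : Fin d ↦
        (MvPolynomial.X i : MvPolynomial (Fin d) (ZMod p)) ^ gapExponent d t j).det), ← hev,
      Finset.mul_sum]
    exact Finset.sum_congr rfl fun k _ ↦ by ring
  rw [Finset.sum_range_succ, Finset.sum_eq_zero fun k hk ↦ by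
    rw [hNlt k (Finset.mem_range.1 hk)]; ring, zero_add, ← hQd, hQm.coeff_natDegree, hQd,
    one_mul] at hsum
  have hD : D.det ≠ 0 := by
    have hDV : D = Matrix.of fun i j ↦ a i * Matrix.vandermonde (fun i ↦ a i ^ 2) i j := by
      ext i j
      simp only [D, Matrix.of_apply, Matrix.vandermonde_apply]
      ring
    rw [hDV, Matrix.det_mul_column]
    refine mul_ne_zero (Finset.prod_ne_zero_iff.2 fun i _ ↦ ha0 i)
      (Matrix.det_vandermonde_ne_zero_iff.2 fun i j hij ↦ ?_)
    by_contra hne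
    rcases sq_eq_sq_iff_eq_or_eq_neg.1 hij with h | h
    exacts [(ha i j hne).1 h, (ha i j hne).2 h]
  have hC : (alternantMulPow (ZMod p) (gapExponent d t) n).coeff (oddExponent d) ≠ 0 := by
    intro h0
    have h := prod_factorial_mul_coeff_alternantMulPow (R := ZMod p) (gapExponent d t)
      (oddExponent d) (n := n) (by
        simp only [oddExponent_apply, sum_two_mul_add_one]
        exact hdeg)
    rw [h0, mul_zero] at h
    refine mul_ne_zero ?_ (det_descPochhammer_gapExponent_ne_zero hd ht) h.symm
    rw [Ne, ZMod.natCast_eq_zero_iff, hp.dvd_factorial]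
    omega
  exact mul_ne_zero (mul_ne_zero (pow_ne_zero _ h2) hC) hD hsum

theorem card_subset_sums_gt {p : ℕ} [Fact p.Prime] {n t : ℕ} (B : Finset (ZMod p))
    (hB : ∀ a ∈ B, -a ∉ B) (hd : 2 * B.card < p) (ht : t ≤ B.card)
    (hn : n < p) (hnt : 2 * (n + t) = B.card * (B.card + 1)) :
    n < (B.powerset.image fun S ↦ S.sum id).card := by
  let a : Fin B.card → ZMod p := fun i ↦ B.equivFin.symm i
  have haB : ∀ i, a i ∈ B := fun i ↦ (B.equivFin.symm i).2
  have hainj : Function.Injective a := Subtype.val_injective.comp B.equivFin.symm.injective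
  refine (card_signed_sums_gt hd ht hn hnt a ?_ ?_).trans_le ?_
  · intro i h0
    exact hB _ (haB i) (by rw [h0, neg_zero, ← h0]; exact haB i)
  · intro i j hij
    refine ⟨hainj.ne hij, fun h ↦ hB _ (haB j) ?_⟩
    rw [← h]
    exact haB i
  · refine (Finset.card_le_card (t := (B.powerset.image fun S ↦ S.sum id).image
      fun x ↦ 2 * x - ∑ i, a i) ?_).trans Finset.card_image_le
    intro x hx
    obtain ⟨ε, -, rfl⟩ := Finset.mem_image.1 hx
    refine Finset.mem_image.2 ⟨_, Finset.mem_image_of_mem _ (Finset.mem_powerset.2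
      (?_ : (Finset.univ.filter fun i ↦ ε i = 1).image a ⊆ B)), ?_⟩
    · intro y hy
      obtain ⟨i, -, rfl⟩ := Finset.mem_image.1 hy
      exact haB i
    · rw [Finset.sum_image (fun _ _ _ _ h ↦ hainj h), Finset.sum_filter, Finset.mul_sum,
        ← Finset.sum_sub_distrib]
      refine Finset.sum_congr rfl fun i _ ↦ ?_
      rcases Int.units_eq_one_or (ε i) with h | h
      · simp [h]; ring
      · simp [h]

theorem two_mul_card_lt_of_forall_neg_notMem {p : ℕ} [Fact p.Prime] (A : Finset (ZMod p))
    (hA : ∀ a ∈ A, -a ∉ A) : 2 * A.card < p := by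
  have h0 : (0 : ZMod p) ∉ A := fun h ↦ hA 0 h (by simpa using h)
  have hdisj : Disjoint A (A.image fun a ↦ -a) := by
    refine Finset.disjoint_left.2 fun a ha h ↦ ?_
    obtain ⟨b, hb, rfl⟩ := Finset.mem_image.1 h
    exact hA b hb ha
  have hlt : (A ∪ A.image fun a ↦ -a).card < Fintype.card (ZMod p) := by
    refine Finset.card_lt_univ_of_notMem (x := 0) ?_
    simpa using h0
  rw [Finset.card_union_of_disjoint hdisj, Finset.card_image_of_injective _ neg_injective,
    ZMod.card] at hlt
  omega

theorem balandraud_subset_sums (p : ℕ) (hp : p.Prime) (A : Finset (ZMod p))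
    (hA : ∀ a ∈ A, -a ∉ A) :
    min p (A.card * (A.card + 1) / 2 + 1) ≤ (A.powerset.image fun S => S.sum id).card := by
  have := Fact.mk hp
  have hcard := two_mul_card_lt_of_forall_neg_notMem A hA
  have heven : ∀ k, 2 * (k * (k + 1) / 2) = k * (k + 1) := fun k ↦
    Nat.mul_div_cancel' (Nat.even_mul_succ_self k).two_dvd
  rcases lt_or_ge (A.card * (A.card + 1) / 2) p with hlt | hge
  · refine (min_le_right _ _).trans ?_
    exact card_subset_sums_gt (t := 0) A hA hcard (Nat.zero_le _) hlt (by simpa using heven _)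
  · refine (min_le_left _ _).trans ?_
    have hex : ∃ k, p - 1 ≤ k * (k + 1) / 2 := ⟨A.card, by omega⟩
    classical
    obtain ⟨B, hBA, hB⟩ := Finset.exists_subset_card_eq (s := A) (n := Nat.find hex)
      (Nat.find_min' hex (by omega))
    have hspec := Nat.find_spec hex
    have hmin : Nat.find hex * (Nat.find hex + 1) / 2 - (p - 1) ≤ Nat.find hex := by
      rcases Nat.eq_zero_or_pos (Nat.find hex) with h0 | hpos
      · rw [h0]
        omega
      · obtain ⟨k, hk⟩ := Nat.exists_eq_succ_of_ne_zero hpos.ne'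
        have h := Nat.find_min hex (m := k) (by omega)
        rw [hk]
        have h1 := heven k
        have h2 := heven (k + 1)
        have h3 : (k + 1) * (k + 1 + 1) = k * (k + 1) + 2 * (k + 1) := by ring
        simp only [Nat.succ_eq_add_one]
        omega
    rw [← hB] at hspec hmin
    have h := card_subset_sums_gt B (fun a ha h ↦ hA a (hBA ha) (hBA h))
      ((Nat.mul_le_mul_left 2 (Finset.card_le_card hBA)).trans_lt hcard) hmin
      (Nat.sub_lt hp.pos one_pos) (by rw [← heven]; omega)
    have hle := Finset.card_le_card
      (Finset.image_subset_image (f := fun S ↦ S.sum id) (Finset.powerset_mono.2 hBA))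
    omega
end

section
/- Let p be a prime and A ⊆ F_p with A ∩ (-A) = ∅ and A nonempty. Then |Σ*(A)| ≥ min{p, |A|(|A|+1)/2}, where Σ*(A) is the set of sums over nonempty subsets of A. -/
/-- The coefficients of `∏ i < d, (X - (2 * i + 1))` in the falling factorial basis. -/
def oddProdCoeff : ℕ → ℕ → ℤ
  | 0, 0 => 1
  | 0, _ + 1 => 0
  | d + 1, 0 => -(2 * d + 1) * oddProdCoeff d 0
  | d + 1, q + 1 => oddProdCoeff d q + (q - 2 * d) * oddProdCoeff d (q + 1)

theorem oddProdCoeff_eq_zero_of_lt {d q : ℕ} (h : d < q) : oddProdCoeff d q = 0 := by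
  induction d generalizing q with
  | zero => cases q with
    | zero => omega
    | succ q => rfl
  | succ d ih => cases q with
    | zero => omega
    | succ q => simp [oddProdCoeff, ih (show d < q by omega), ih (show d < q + 1 by omega)]

open Nat in
theorem oddProdCoeff_mul_eq (q j : ℕ) :
    oddProdCoeff (q + j) q * (2 ^ j * q ! * j !) = (-1) ^ j * (q + 2 * j)! := by
  induction h : q + j generalizing q j with
  | zero =>
    obtain ⟨rfl, rfl⟩ : q = 0 ∧ j = 0 := by omega
    simp [oddProdCoeff]
  | succ d ih =>
    rcases q with _ | q
    · obtain rfl : j = d + 1 := by omega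
      have h₁ := ih 0 d (by omega)
      have h₂ : (0 + 2 * (d + 1)) = 0 + 2 * d + 1 + 1 := by ring
      rw [h₂, oddProdCoeff]
      simp only [Nat.factorial_succ]
      push_cast at h₁ ⊢
      linear_combination (-(2 * d + 1) * (2 * (d + 1)) : ℤ) * h₁
    · rcases j with _ | j
      · have h₁ := ih q 0 (by omega)
        rw [oddProdCoeff, oddProdCoeff_eq_zero_of_lt (show d < q + 1 by omega)]
        simp only [Nat.factorial_succ, mul_zero, add_zero] at h₁ ⊢
        push_cast at h₁ ⊢
        linear_combination (q + 1 : ℤ) * h₁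
      · have h₁ := ih q (j + 1) (by omega)
        have h₂ := ih (q + 1) j (by omega)
        obtain rfl : d = q + 1 + j := by omega
        rw [show q + 2 * (j + 1) = q + 2 * j + 1 + 1 by ring] at h₁
        rw [show q + 1 + 2 * j = q + 2 * j + 1 by ring] at h₂
        rw [show q + 1 + 2 * (j + 1) = q + 2 * j + 1 + 1 + 1 by ring, oddProdCoeff]
        simp only [Nat.factorial_succ] at h₁ h₂ ⊢
        push_cast at h₁ h₂ ⊢
        linear_combination (q + 1 : ℤ) * h₁ - (q + 2 * j + 2 : ℤ) * (2 * (j + 1)) * h₂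

theorem oddProdCoeff_cast_ne_zero {p d q : ℕ} [Fact p.Prime] (hq : q ≤ d) (hd : 2 * d < p) :
    (oddProdCoeff d q : ZMod p) ≠ 0 := by
  obtain ⟨j, rfl⟩ := Nat.exists_eq_add_of_le hq
  intro h
  have h₁ := congrArg (Int.cast : ℤ → ZMod p) (oddProdCoeff_mul_eq q j)
  push_cast at h₁
  rw [h, zero_mul, eq_comm, mul_eq_zero, ZMod.natCast_eq_zero_iff,
    (Fact.out : p.Prime).dvd_factorial] at h₁
  rcases h₁ with h₁ | h₁
  · exact pow_ne_zero _ (neg_ne_zero.2 one_ne_zero) h₁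
  · omega

open Polynomial Finset in
theorem prod_X_sub_odd (R : Type*) [CommRing R] (d : ℕ) :
    ∏ i ∈ range d, (X - C ((2 * i + 1 : ℕ) : R)) =
      ∑ c ∈ range (d + 1), C (oddProdCoeff d c : R) * descPochhammer R c := by
  induction d with
  | zero => simp [oddProdCoeff]
  | succ d ih =>
    have hC : (C 2 : R[X]) = 2 := map_ofNat C 2
    have h₁ := sum_range_succ' (fun c ↦ C (oddProdCoeff d c : R) * (c - 2 * d - 1) *
      descPochhammer R c) (d + 1)
    rw [sum_range_succ, oddProdCoeff_eq_zero_of_lt (Nat.lt_succ_self d)] at h₁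
    simp only [Int.cast_zero, map_zero, zero_mul, add_zero] at h₁
    have h₂ : ∑ c ∈ range (d + 1), C (oddProdCoeff d c : R) * descPochhammer R c *
          (X - C ((2 * d + 1 : ℕ) : R)) =
        ∑ c ∈ range (d + 1), C (oddProdCoeff d c : R) * descPochhammer R (c + 1) +
        ∑ c ∈ range (d + 1), C (oddProdCoeff d c : R) * (c - 2 * d - 1) * descPochhammer R c := by
      rw [← sum_add_distrib]
      refine sum_congr rfl fun c _ ↦ ?_
      rw [descPochhammer_succ_right]
      simp only [Nat.cast_add, Nat.cast_mul, Nat.cast_ofNat, Nat.cast_one, map_add, map_mul,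
        map_natCast, map_ofNat, map_one]
      ring
    rw [prod_range_succ, ih, sum_mul, h₂, h₁, ← add_assoc, ← sum_add_distrib,
      sum_range_succ' _ (d + 1)]
    congr 1
    · refine sum_congr rfl fun c _ ↦ ?_
      simp [oddProdCoeff, hC]
      ring
    · simp [oddProdCoeff, hC]
      ring

open Polynomial Finset in
theorem natDegree_sum_descPochhammer_le {K : Type*} [Field K] (u : ℕ → K) (n : ℕ) :
    (∑ c ∈ range (n + 1), C (u c) * descPochhammer K c).natDegree ≤ n := by
  refine natDegree_sum_le_of_forall_le _ _ fun c hc ↦ (natDegree_C_mul_le _ _).trans ?_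
  rw [descPochhammer_natDegree]
  exact Nat.lt_succ_iff.1 (mem_range.1 hc)

open Polynomial Finset in
theorem eq_zero_of_sum_descPochhammer_eq_zero {K : Type*} [Field K] {u : ℕ → K} {n : ℕ}
    (h : ∑ c ∈ range n, C (u c) * descPochhammer K c = 0) : ∀ c < n, u c = 0 := by
  induction n with
  | zero => simp
  | succ n ih =>
    have hn : u n = 0 := by
      have h₁ := congrArg (coeff · n) h
      have h₂ := (monic_descPochhammer K n).coeff_natDegree
      rw [descPochhammer_natDegree] at h₂
      simp only [sum_range_succ, coeff_add, coeff_C_mul, coeff_zero, h₂, mul_one] at h₁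
      rcases n with _ | n
      · simpa using h₁
      · rwa [coeff_eq_zero_of_natDegree_lt (Nat.lt_succ_of_le (natDegree_sum_descPochhammer_le u n)),
          zero_add] at h₁
    rw [sum_range_succ, hn, map_zero, zero_mul, add_zero] at h
    intro c hc
    rcases Nat.lt_succ_iff_lt_or_eq.1 hc with hc | rfl
    · exact ih h c hc
    · exact hn

open Polynomial Finset in
theorem eq_zero_of_sum_descPochhammer_eval_odd {p d q : ℕ} [Fact p.Prime] (hd : 2 * d < p)
    (hq : q ≤ d) {u : ℕ → ZMod p} (huq : u q = 0)
    (hu : ∀ j < d, ∑ c ∈ range (d + 1), u c * (2 * j + 1).descFactorial c = 0) :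
    ∀ c ≤ d, u c = 0 := by
  set g : ℕ → ZMod p := fun c ↦ u c - u d * oddProdCoeff d c with hg
  set f := ∑ c ∈ range (d + 1), C (g c) * descPochhammer (ZMod p) c with hf
  have hdd : oddProdCoeff d d = 1 := by simpa [Nat.factorial_ne_zero] using oddProdCoeff_mul_eq d 0
  have hgd : g d = 0 := by simp [hg, hdd]
  have hfP : f = ∑ c ∈ range (d + 1), C (u c) * descPochhammer (ZMod p) c -
      C (u d) * ∏ i ∈ range d, (X - C ((2 * i + 1 : ℕ) : ZMod p)) := by
    rw [prod_X_sub_odd, mul_sum, ← sum_sub_distrib]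
    refine sum_congr rfl fun c _ ↦ ?_
    simp [hg]
    ring
  have hf₀ : f = 0 := by
    rcases d with _ | d
    · simp [hf, hgd]
    refine eq_zero_of_natDegree_lt_card_of_eval_eq_zero (ι := Fin (d + 1)) f
      (f := fun j ↦ ((2 * j + 1 : ℕ) : ZMod p)) ?_ ?_ ?_
    · intro i j hij
      have := (ZMod.natCast_eq_natCast_iff' _ _ _).1 hij
      rw [Nat.mod_eq_of_lt (by omega), Nat.mod_eq_of_lt (by omega)] at this
      omega
    · intro j
      have h₁ : eval ((2 * j + 1 : ℕ) : ZMod p)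
          (∏ i ∈ range (d + 1), (X - C ((2 * i + 1 : ℕ) : ZMod p))) = 0 := by
        rw [eval_prod]
        exact prod_eq_zero (mem_range.2 j.2) (by simp)
      rw [hfP, eval_sub, eval_mul, h₁, mul_zero, sub_zero, eval_finsetSum]
      simpa only [eval_mul, eval_C, descPochhammer_eval_eq_descFactorial] using hu j j.2
    · rw [hf, sum_range_succ, hgd, map_zero, zero_mul, add_zero, Fintype.card_fin]
      exact Nat.lt_succ_of_le (natDegree_sum_descPochhammer_le g d)
  have hg₀ : ∀ c < d + 1, g c = 0 := eq_zero_of_sum_descPochhammer_eq_zero hf₀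
  have hud : u d = 0 := by
    have := hg₀ q (by omega)
    simp only [hg, huq, zero_sub, neg_eq_zero, mul_eq_zero] at this
    exact this.resolve_right (oddProdCoeff_cast_ne_zero hq hd)
  intro c hc
  simpa [hg, hud] using hg₀ c (by omega)

theorem det_descFactorial_succAbove_ne_zero {p d : ℕ} [Fact p.Prime] (hd : 2 * d < p)
    (q : Fin (d + 1)) :
    (Matrix.of fun i j : Fin d ↦
      ((2 * (j : ℕ) + 1).descFactorial (q.succAbove i) : ZMod p)).det ≠ 0 := by
  intro h
  obtain ⟨v, hv, hv₀⟩ := Matrix.exists_vecMul_eq_zero_iff.2 h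
  set w : Fin (d + 1) → ZMod p := q.insertNth 0 v with hw
  set u : ℕ → ZMod p := fun c ↦ if h : c < d + 1 then w ⟨c, h⟩ else 0 with hu
  have huw (i : Fin (d + 1)) : u i = w i := by simp only [hu, i.2, dite_true, Fin.eta]
  have key := eq_zero_of_sum_descPochhammer_eval_odd (u := u) hd (Nat.lt_succ_iff.1 q.2)
    (by simp [huw, hw]) (fun j hj ↦ by
      rw [Finset.sum_range, Fin.sum_univ_succAbove _ q]
      simpa [huw, hw, Matrix.vecMul, dotProduct] using congrFun hv₀ ⟨j, hj⟩)
  refine hv (funext fun i ↦ ?_)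
  have := key (q.succAbove i) (Nat.lt_succ_iff.1 (q.succAbove i).2)
  simpa [huw, hw] using this

open MvPolynomial in
/-- The Vandermonde determinant of the squares of the variables, with decreasing exponents. -/
noncomputable def squareVandermonde (R : Type*) [CommRing R] (d : ℕ) : MvPolynomial (Fin d) R :=
  (Matrix.of fun i j : Fin d ↦ (X i : MvPolynomial (Fin d) R) ^ (2 * (d - 1 - (j : ℕ)))).det

open MvPolynomial in
theorem isHomogeneous_squareVandermonde (R : Type*) [CommRing R] (d : ℕ) :
    (squareVandermonde R d).IsHomogeneous (∑ j : Fin d, 2 * (d - 1 - (j : ℕ))) := by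
  rw [squareVandermonde, Matrix.det_apply']
  refine IsHomogeneous.sum _ _ _ fun σ _ ↦ ?_
  rw [← map_intCast (C : R →+* MvPolynomial (Fin d) R)]
  exact (IsHomogeneous.prod _ _ _ fun j _ ↦ isHomogeneous_X_pow _ _).C_mul _

open MvPolynomial in
theorem sq_injective_of_eval_squareVandermonde_ne_zero {R : Type*} [CommRing R] {d : ℕ}
    {s : Fin d → R} (h : eval s (squareVandermonde R d) ≠ 0) :
    Function.Injective fun i ↦ s i ^ 2 := by
  intro i j hij
  by_contra hne
  refine h ?_
  rw [squareVandermonde, RingHom.map_det]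
  refine Matrix.det_zero_of_row_eq hne (funext fun k ↦ ?_)
  simp only [RingHom.mapMatrix_apply, Matrix.map_apply, Matrix.of_apply, map_pow, eval_X, pow_mul]
  exact congrArg (· ^ _) hij

open Nat in
theorem Finsupp.prod_factorial_mul_multinomial {ι : Type*} [Fintype ι] (f : ι →₀ ℕ) :
    (∏ i, (f i)!) * f.multinomial = (∑ i, f i)! := by
  have h₁ : ∏ i, (f i)! = ∏ i ∈ f.support, (f i)! :=
    (Finset.prod_subset (Finset.subset_univ _) fun i _ hi ↦ by
      simp [Finsupp.notMem_support_iff.1 hi]).symm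
  have h₂ : ∑ i, f i = ∑ i ∈ f.support, f i :=
    (Finset.sum_subset (Finset.subset_univ _) fun i _ hi ↦ Finsupp.notMem_support_iff.1 hi).symm
  rw [h₁, h₂]
  exact Nat.multinomial_spec _ _

open MvPolynomial Nat in
theorem prod_factorial_mul_coeff_pow_mul_squareVandermonde (R : Type*) [CommRing R] {d w : ℕ}
    {t : Fin d →₀ ℕ} {c : Fin d → ℕ} (htc : ∀ i, t i + c i = 2 * d - 1)
    (ht : ∑ i, t i = w + ∑ j : Fin d, 2 * (d - 1 - (j : ℕ))) :
    ((∏ j : Fin d, (2 * (j : ℕ) + 1)! : ℕ) : R) *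
        coeff t ((∑ i, X i) ^ w * squareVandermonde R d) =
      w ! * (Matrix.of fun i j : Fin d ↦ ((2 * (j : ℕ) + 1).descFactorial (c i) : R)).det := by
  rw [squareVandermonde, Matrix.det_apply', Matrix.det_apply', Finset.mul_sum, coeff_sum,
    Finset.mul_sum, Finset.mul_sum]
  refine Finset.sum_congr rfl fun σ _ ↦ ?_
  set e : Fin d → ℕ := fun j ↦ 2 * (d - 1 - (j : ℕ)) with he
  set u : Fin d →₀ ℕ := Finsupp.equivFunOnFinite.symm fun i ↦ e (σ.symm i) with hu
  have hmon : ∏ j, (X (σ j) : MvPolynomial (Fin d) R) ^ e j = monomial u 1 := by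
    rw [monomial_eq, map_one, one_mul, Finsupp.prod_fintype _ _ (by simp),
      ← Equiv.prod_comp σ fun i ↦ (X i : MvPolynomial (Fin d) R) ^ u i]
    simp [hu]
  have hsub (hut : u ≤ t) : ∑ i, (t - u) i = w := by
    have h₁ : ∑ i, (t - u) i + ∑ i, u i = ∑ i, t i := by
      rw [← Finset.sum_add_distrib]
      exact Finset.sum_congr rfl fun i _ ↦ Nat.sub_add_cancel (hut i)
    have h₂ : ∑ i, u i = Finset.univ.sum e := by
      rw [← Equiv.sum_comp σ]
      simp [hu]
    omega
  have key : (∏ j : Fin d, (2 * (j : ℕ) + 1)!) * (if u ≤ t then (t - u).multinomial else 0) =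
      w ! * ∏ j : Fin d, (2 * (j : ℕ) + 1).descFactorial (c (σ j)) := by
    split_ifs with hut
    · have hut' (j : Fin d) : e j ≤ t (σ j) := by simpa [hu] using hut (σ j)
      have h₂ : ∏ i, ((t - u) i)! = ∏ j : Fin d, (2 * (j : ℕ) + 1 - c (σ j))! := by
        rw [← Equiv.prod_comp σ]
        refine Finset.prod_congr rfl fun j _ ↦ congrArg _ ?_
        have h₁ := hut' j
        have h₂ := htc (σ j)
        have h₃ : (t - u) (σ j) = t (σ j) - e j := by simp [hu]
        rw [h₃]
        simp only [he] at h₁ ⊢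
        omega
      rw [← hsub hut, ← Finsupp.prod_factorial_mul_multinomial, h₂, mul_right_comm,
        ← Finset.prod_mul_distrib]
      congr 1
      refine Finset.prod_congr rfl fun j _ ↦ (Nat.factorial_mul_descFactorial ?_).symm
      have h₁ := hut' j
      have h₂ := htc (σ j)
      simp only [he] at h₁
      omega
    · obtain ⟨i, hi⟩ : ∃ i, t i < u i := by
        by_contra! hcon
        exact hut hcon
      rw [mul_zero, eq_comm, _root_.mul_eq_zero]
      refine Or.inr (Finset.prod_eq_zero (Finset.mem_univ (σ.symm i)) ?_)
      rw [Nat.descFactorial_eq_zero_iff_lt, Equiv.apply_symm_apply]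
      have h₂ := htc i
      have h₃ : u i = e (σ.symm i) := by simp [hu]
      rw [h₃] at hi
      simp only [he] at hi
      omega
  have hcoeff : coeff t ((∑ i, X i) ^ w * monomial u (1 : R)) =
      ((if u ≤ t then (t - u).multinomial else 0 : ℕ) : R) := by
    rw [coeff_mul_monomial']
    split_ifs with hut
    · rw [coeff_sum_X_pow_of_fintype, Finsupp.sum_fintype _ _ (by simp), if_pos (hsub hut),
        mul_one]
    · simp
  simp only [Matrix.of_apply]
  rw [hmon, ← map_intCast (C : R →+* MvPolynomial (Fin d) R), mul_left_comm, coeff_C_mul, hcoeff,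
    mul_left_comm, ← Nat.cast_mul, key, mul_left_comm (w ! : R)]
  push_cast
  rfl

open Polynomial in
theorem coeff_aeval_mul_of_isHomogeneous {σ R : Type*} [CommRing R] {Q : R[X]} {w m : ℕ}
    (hQ : Q.Monic) (hw : Q.natDegree = w) {s V : MvPolynomial σ R} (hs : s.IsHomogeneous 1)
    (hV : V.IsHomogeneous m) {t : σ →₀ ℕ} (ht : t.degree = w + m) :
    (aeval s Q * V).coeff t = (s ^ w * V).coeff t := by
  rw [aeval_eq_sum_range, hw, Finset.sum_range_succ, ← hw, hQ.coeff_natDegree, one_smul, hw,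
    add_mul, MvPolynomial.coeff_add, add_eq_right, Finset.sum_mul, MvPolynomial.coeff_sum]
  refine Finset.sum_eq_zero fun k hk ↦ ?_
  rw [smul_mul_assoc, MvPolynomial.coeff_smul, ((hs.pow k).mul hV).coeff_eq_zero, smul_zero]
  have := Finset.mem_range.1 hk
  omega

open Polynomial in
theorem totalDegree_aeval_mul_le {σ R : Type*} [CommRing R] (Q : R[X]) {m : ℕ}
    {s V : MvPolynomial σ R} (hs : s.IsHomogeneous 1) (hV : V.IsHomogeneous m) :
    (aeval s Q * V).totalDegree ≤ Q.natDegree + m := by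
  rw [aeval_eq_sum_range, Finset.sum_mul]
  refine MvPolynomial.totalDegree_finsetSum_le fun k hk ↦ ?_
  rw [smul_mul_assoc]
  refine (MvPolynomial.totalDegree_smul_le _ _).trans (((hs.pow k).mul hV).totalDegree_le.trans ?_)
  have := Finset.mem_range.1 hk
  omega

theorem sum_two_mul_sub_succAbove {d : ℕ} (q : Fin (d + 1)) :
    ∑ i : Fin d, (2 * d - 1 - (q.succAbove i : ℕ)) =
      (d * (d - 1) / 2 + q) + ∑ j : Fin d, 2 * (d - 1 - (j : ℕ)) := by
  have h₁ : ∑ i : Fin d, (2 * d - 1 - (q.succAbove i : ℕ)) + ∑ i : Fin d, (q.succAbove i : ℕ) =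
      d * (2 * d - 1) := by
    rw [← Finset.sum_add_distrib, Finset.sum_congr rfl fun i _ ↦ show _ = 2 * d - 1 by omega]
    simp
  have h₂ : ∑ j : Fin d, 2 * (d - 1 - (j : ℕ)) + 2 * ∑ j : Fin d, (j : ℕ) =
      d * (2 * (d - 1)) := by
    rw [Finset.mul_sum, ← Finset.sum_add_distrib,
      Finset.sum_congr rfl fun i _ ↦ show _ = 2 * (d - 1) by omega]
    simp
  have h₃ := Fin.sum_univ_succAbove (fun i : Fin (d + 1) ↦ (i : ℕ)) q
  have h₄ := Finset.sum_range_id_mul_two d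
  have h₅ := Finset.sum_range_succ (fun i ↦ i) d
  rw [Finset.sum_range] at h₅ h₄
  rw [Finset.sum_range] at h₅
  rw [← h₄, Nat.mul_div_cancel _ two_pos]
  rcases d with _ | d
  · simp
  · simp only [Nat.add_sub_cancel] at h₂ h₄
    rw [show 2 * (d + 1) - 1 = 2 * d + 1 by omega] at h₁
    simp only [Nat.add_sub_cancel]
    rw [show 2 * (d + 1) - 1 = 2 * d + 1 by omega]
    nlinarith

open Polynomial Finset in
/-- Sums `∑ i, s i` with `s i ∈ S i` and distinct squares `s i ^ 2` take more than
`d * (d - 1) / 2 + q` values when the sets `S i` are large enough. -/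
theorem exists_sq_injective_sum_notMem {p d : ℕ} [Fact p.Prime] (hd : 2 * d < p)
    (q : Fin (d + 1)) (hq : d * (d - 1) / 2 + q < p) (S : Fin d → Finset (ZMod p))
    (hS : ∀ i, 2 * d - 1 - q.succAbove i < #(S i)) (E : Finset (ZMod p))
    (hE : #E ≤ d * (d - 1) / 2 + q) :
    ∃ s : Fin d → ZMod p, (∀ i, s i ∈ S i) ∧ (Function.Injective fun i ↦ s i ^ 2) ∧
      ∑ i, s i ∉ E := by
  set w := d * (d - 1) / 2 + (q : ℕ) with hw
  set t : Fin d →₀ ℕ := Finsupp.equivFunOnFinite.symm fun i ↦ 2 * d - 1 - (q.succAbove i : ℕ)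
    with ht
  have hsum := sum_two_mul_sub_succAbove q
  rw [← hw] at hsum
  set N := ∑ j : Fin d, 2 * (d - 1 - (j : ℕ)) with hN
  set Q : (ZMod p)[X] := (∏ e ∈ E, (X - C e)) * X ^ (w - #E) with hQ
  have hQE : (∏ e ∈ E, (X - C e)).Monic := monic_prod_of_monic _ _ fun e _ ↦ monic_X_sub_C e
  have hQm : Q.Monic := hQE.mul (monic_X_pow _)
  have hQd : Q.natDegree = w := by
    rw [hQ, hQE.natDegree_mul (monic_X_pow _), natDegree_prod_of_monic _ _
      fun e _ ↦ monic_X_sub_C e]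
    simp
    omega
  set s₀ : MvPolynomial (Fin d) (ZMod p) := ∑ i, MvPolynomial.X i with hs₀
  have hs₁ : s₀.IsHomogeneous 1 :=
    MvPolynomial.IsHomogeneous.sum _ _ _ fun i _ ↦ MvPolynomial.isHomogeneous_X _ _
  have hV := isHomogeneous_squareVandermonde (ZMod p) d
  have htd : t.degree = w + N := by
    rw [Finsupp.degree_eq_sum, ← hsum]
    simp [ht]
  have hcoeff : (aeval s₀ Q * squareVandermonde (ZMod p) d).coeff t ≠ 0 := by
    rw [coeff_aeval_mul_of_isHomogeneous hQm hQd hs₁ hV htd]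
    intro h
    have h₁ := prod_factorial_mul_coeff_pow_mul_squareVandermonde (ZMod p) (t := t) (w := w)
      (c := fun i ↦ (q.succAbove i : ℕ))
      (fun i ↦ by simp [ht]; omega) (by simpa [ht] using hsum)
    rw [h, mul_zero, eq_comm, mul_eq_zero, ZMod.natCast_eq_zero_iff,
      (Fact.out : p.Prime).dvd_factorial] at h₁
    exact h₁.elim (by omega) (det_descFactorial_succAbove_ne_zero hd q)
  have htot : (aeval s₀ Q * squareVandermonde (ZMod p) d).totalDegree = t.degree := by
    refine le_antisymm ?_ ?_
    · rw [htd, ← hQd]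
      exact totalDegree_aeval_mul_le Q hs₁ hV
    · exact MvPolynomial.le_totalDegree (MvPolynomial.mem_support_iff.2 hcoeff)
  obtain ⟨s, hsS, hs⟩ := MvPolynomial.combinatorial_nullstellensatz_exists_eval_nonzero _ t hcoeff
    htot S (by simpa [ht] using hS)
  rw [map_mul] at hs
  refine ⟨s, hsS, sq_injective_of_eval_squareVandermonde_ne_zero (right_ne_zero_of_mul hs), ?_⟩
  intro hmem
  refine left_ne_zero_of_mul hs ?_
  rw [hQ, map_mul, map_prod, map_mul, map_prod, prod_eq_zero hmem, zero_mul]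
  simp [hs₀]

open Finset in
/-- Choosing signs injectively up to sign: such a sum of elements of `A ∪ -A` is twice a subset sum
of `A` minus the sum of `A`. -/
theorem exists_subset_sum_of_sq_injective {K : Type*} [Field K] [DecidableEq K] {A : Finset K}
    {s : Fin #A → K} (hs : ∀ i, s i ∈ A ∨ -s i ∈ A)
    (hinj : Function.Injective fun i ↦ s i ^ 2) :
    ∑ i, s i = 2 * (∑ a ∈ (univ.filter fun i ↦ s i ∈ A).image s, a) - ∑ a ∈ A, a := by
  set f : Fin #A → K := fun i ↦ if s i ∈ A then s i else -s i with hf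
  have hfA (i : Fin #A) : f i ∈ A := by
    by_cases h : s i ∈ A
    · simp [hf, h]
    · simpa [hf, h] using (hs i).resolve_left h
  have hf_inj : Function.Injective f := by
    intro i j hij
    have hsq (k : Fin #A) : f k ^ 2 = s k ^ 2 := by
      by_cases h : s k ∈ A <;> simp [hf, h]
    exact hinj (by simp only [← hsq, hij])
  have hs_inj : Function.Injective s := fun i j hij ↦ hinj (by simp only [hij])
  have himage : univ.image f = A :=
    eq_of_subset_of_card_le (image_subset_iff.2 fun i _ ↦ hfA i)
      (by rw [card_image_of_injective _ hf_inj, card_univ, Fintype.card_fin])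
  have hsumA : ∑ a ∈ A, a = ∑ i, f i := by
    conv_lhs => rw [← himage]
    exact sum_image hf_inj.injOn
  rw [sum_image hs_inj.injOn, hsumA, sum_filter, mul_sum, ← sum_sub_distrib]
  refine sum_congr rfl fun i _ ↦ ?_
  by_cases h : s i ∈ A
  · simp only [hf, h, if_true]
    ring
  · simp [hf, h]

open Finset in
theorem two_mul_card_lt_of_neg_notMem {p : ℕ} [Fact p.Prime] {A : Finset (ZMod p)}
    (hA : ∀ a ∈ A, -a ∉ A) : 2 * #A < p ∧ #(A ∪ A.image Neg.neg) = 2 * #A := by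
  have hdisj : Disjoint A (A.image Neg.neg) := by
    rw [disjoint_right]
    intro b hb
    obtain ⟨a, ha, rfl⟩ := mem_image.1 hb
    exact hA a ha
  have hcard : #(A ∪ A.image Neg.neg) = 2 * #A := by
    rw [card_union_of_disjoint hdisj, card_image_of_injective _ neg_injective, two_mul]
  refine ⟨?_, hcard⟩
  have h₀ : (0 : ZMod p) ∉ A ∪ A.image Neg.neg := by
    have h₁ : (0 : ZMod p) ∉ A := fun h ↦ hA 0 h (by simpa using h)
    simp [h₁]
  have := card_lt_univ_of_notMem h₀
  rwa [hcard, ZMod.card] at this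

open Finset in
theorem min_le_card_nonempty_subset_sums {p : ℕ} [Fact p.Prime] {A : Finset (ZMod p)}
    (hne : A.Nonempty) (hA : ∀ a ∈ A, -a ∉ A) (hcard : #A * (#A - 1) / 2 < p) :
    min p (#A * (#A + 1) / 2) ≤
      #((A.powerset.filter fun S ↦ S.Nonempty).image fun S ↦ S.sum id) := by
  set T := (A.powerset.filter fun S ↦ S.Nonempty).image fun S ↦ S.sum id with hT
  set d := #A with hd
  have hd₀ : 0 < d := hne.card_pos
  obtain ⟨hdp, hunion⟩ := two_mul_card_lt_of_neg_notMem hA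
  have htri : d * (d + 1) / 2 = d * (d - 1) / 2 + d := by
    obtain ⟨k, hk⟩ := Nat.exists_eq_add_of_lt hd₀
    have : d * (d + 1) = d * (d - 1) + 2 * d := by
      rw [hk]
      simp
      ring
    omega
  by_contra! hlt
  obtain ⟨q, hq⟩ : ∃ q, min p (d * (d + 1) / 2) = d * (d - 1) / 2 + q + 1 :=
    ⟨min p (d * (d + 1) / 2) - d * (d - 1) / 2 - 1, by omega⟩
  have hqd : q < d := by omega
  obtain ⟨i₀, hi₀⟩ : ∃ i₀ : Fin d, (⟨q, by omega⟩ : Fin (d + 1)).succAbove i₀ = Fin.last d :=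
    Fin.exists_succAbove_eq (Fin.ne_of_val_ne hqd.ne')
  obtain ⟨s, hsS, hinj, hsE⟩ :=
    exists_sq_injective_sum_notMem (d := d) hdp ⟨q, by omega⟩
      (by simp only; omega) (fun i ↦ if i = i₀ then A else A ∪ A.image Neg.neg)
      (fun i ↦ by
        by_cases h : i = i₀
        · subst h
          rw [hi₀, if_pos rfl, Fin.val_last]
          omega
        · rw [if_neg h, hunion]
          omega)
      (T.image fun x ↦ 2 * x - ∑ a ∈ A, a)
      (card_image_le.trans (by simp only; omega))
  have hsA (i : Fin d) : s i ∈ A ∨ -s i ∈ A := by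
    have h := hsS i
    split_ifs at h
    · exact Or.inl h
    · rcases mem_union.1 h with h | h
      · exact Or.inl h
      · obtain ⟨a, ha, hai⟩ := mem_image.1 h
        exact Or.inr (by simpa [← hai] using ha)
  refine hsE (mem_image.2 ⟨_, mem_image.2 ⟨_, mem_filter.2 ⟨mem_powerset.2 ?_, ?_⟩, rfl⟩,
    (exists_subset_sum_of_sq_injective hsA hinj).symm⟩)
  · rw [image_subset_iff]
    exact fun i hi ↦ (mem_filter.1 hi).2
  · exact ⟨s i₀, mem_image_of_mem _ (mem_filter.2 ⟨mem_univ _, by simpa using hsS i₀⟩)⟩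

theorem balandraud_nonempty_subset_sums (p : ℕ) (hp : p.Prime) (A : Finset (ZMod p))
    (hne : A.Nonempty) (hA : ∀ a ∈ A, -a ∉ A) :
    min p (A.card * (A.card + 1) / 2) ≤
      (((A.powerset.filter fun S => S.Nonempty)).image fun S => S.sum id).card := by
  have : Fact p.Prime := ⟨hp⟩
  induction A using Finset.strongInduction with
  | H A ih =>
    rcases lt_or_ge (A.card * (A.card - 1) / 2) p with h | h
    · exact min_le_card_nonempty_subset_sums hne hA h
    · obtain ⟨a, ha⟩ := hne
      have hcard := Finset.card_erase_of_mem ha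
      have hpos := hp.pos
      have hB : (A.erase a).Nonempty := by
        rw [← Finset.card_pos, hcard]
        by_contra! h₀
        rw [Nat.le_zero.1 h₀] at h
        omega
      have hle := ih (A.erase a) (Finset.erase_ssubset ha) hB fun b hb hb' ↦
        hA b (Finset.mem_of_mem_erase hb) (Finset.mem_of_mem_erase hb')
      rw [hcard, Nat.sub_add_cancel (Finset.card_pos.2 ⟨a, ha⟩), mul_comm (A.card - 1),
        min_eq_left h] at hle
      refine (min_le_left _ _).trans (hle.trans (Finset.card_le_card ?_))
      exact Finset.image_subset_image (Finset.filter_subset_filter _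
        (Finset.powerset_mono.2 (Finset.erase_subset a A)))
end

section
/- Let p be a prime, A ⊆ F_p with A ∩ (-A) = ∅, and α an integer with 0 ≤ α ≤ |A|. Then |Σ^α(A)| ≥ min{p, |A|(|A|+1)/2 - α(α+1)/2 + 1}, where Σ^α(A) is the set of sums of at most |A| - α pairwise distinct elements of A. -/
/-- `SigmaLe A α` is `Σ^α(A)`, the set of sums of at most `|A| - α` pairwise distinct
elements of `A`. -/
def SigmaLe {M : Type*} [AddCommMonoid M] [DecidableEq M] (A : Finset M) (α : ℕ) : Finset M :=
  ((A.powerset.filter fun S => S.card ≤ A.card - α)).image fun S => S.sum id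

open Finset MvPolynomial

section Coefficient

variable {F ι κ : Type*} [Field F]

theorem coeff_eq_zero_of_totalDegree_lt_degree {P : MvPolynomial ι F} {c : ι →₀ ℕ}
    (h : P.totalDegree < c.degree) : coeff c P = 0 :=
  coeff_eq_zero_of_totalDegree_lt (by simpa [Finsupp.degree_apply] using h)

theorem totalDegree_prod_sub_C_le (s : Finset κ) (L : κ → MvPolynomial ι F) (e : κ → F)
    (hL : ∀ k ∈ s, (L k).totalDegree ≤ 1) :
    (∏ k ∈ s, (L k - C (e k))).totalDegree ≤ #s := by
  refine (totalDegree_finsetProd _ _).trans ?_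
  rw [card_eq_sum_ones]
  exact sum_le_sum fun k hk => (totalDegree_sub_C_le _ _).trans (hL k hk)

/-- Coefficients in the top degree do not see the constant terms of the linear factors. -/
theorem coeff_prod_sub_C_mul (c : ι →₀ ℕ) (s : Finset κ) (L : κ → MvPolynomial ι F) (e : κ → F)
    (hL : ∀ k ∈ s, (L k).totalDegree ≤ 1) (Q : MvPolynomial ι F)
    (hQ : #s + Q.totalDegree ≤ c.degree) :
    coeff c ((∏ k ∈ s, (L k - C (e k))) * Q) = coeff c ((∏ k ∈ s, L k) * Q) := by
  classical
  induction s using Finset.induction_on generalizing Q with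
  | empty => simp
  | insert k s hk ih =>
    have hLk := hL k (mem_insert_self _ _)
    have hLs : ∀ k ∈ s, (L k).totalDegree ≤ 1 := fun j hj => hL j (mem_insert_of_mem hj)
    rw [card_insert_of_notMem hk] at hQ
    have hmul := totalDegree_mul (L k) Q
    have h0 : coeff c ((∏ k ∈ s, (L k - C (e k))) * Q) = 0 := by
      apply coeff_eq_zero_of_totalDegree_lt_degree
      have h1 := totalDegree_mul (∏ k ∈ s, (L k - C (e k))) Q
      have h2 := totalDegree_prod_sub_C_le s L e hLs
      omega
    rw [prod_insert hk, prod_insert hk,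
      show (L k - C (e k)) * (∏ k ∈ s, (L k - C (e k))) * Q =
        (∏ k ∈ s, (L k - C (e k))) * (L k * Q) - C (e k) * ((∏ k ∈ s, (L k - C (e k))) * Q) by ring,
      coeff_sub, coeff_C_mul, h0, ih hLs (L k * Q) (by omega)]
    rw [mul_zero, sub_zero]
    congr 1
    ring

/-- A converse of the Combinatorial Nullstellensatz: if a polynomial takes exactly one nonzero
value on a grid, then its coefficient at the top exponent of the grid is nonzero. -/
theorem coeff_ne_zero_of_unique_eval_ne_zero [Fintype ι] (P : MvPolynomial ι F) (c : ι →₀ ℕ)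
    (hdeg : P.totalDegree ≤ c.degree) (S : ι → Finset F) (hS : ∀ i, #(S i) = c i + 1)
    (s : ι → F) (hs : ∀ i, s i ∈ S i) (hPs : eval s P ≠ 0)
    (huniq : ∀ x : ι → F, (∀ i, x i ∈ S i) → eval x P ≠ 0 → x = s) : coeff c P ≠ 0 := by
  classical
  intro hP
  set T : Finset (Σ _ : ι, F) := univ.sigma fun i => (S i).erase (s i) with hT
  have hcard : #T = c.degree := by
    simp [hT, Finsupp.degree_eq_sum, card_erase_of_mem (hs _), hS]
  have hL : ∀ k ∈ T, (X k.1 : MvPolynomial ι F).totalDegree ≤ 1 := fun k _ => by simp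
  set Q : MvPolynomial ι F := ∏ k ∈ T, (X k.1 - C k.2) with hQ
  have hQc : coeff c Q = 1 := by
    have h := coeff_prod_sub_C_mul c T (fun k => (X k.1 : MvPolynomial ι F)) (fun k => k.2) hL 1
      (by simp [hcard])
    rw [mul_one, mul_one] at h
    rw [hQ, h, hT, prod_sigma]
    simp only [prod_const, card_erase_of_mem (hs _), hS, add_tsub_cancel_right]
    have : (∏ i, X i ^ c i : MvPolynomial ι F) = monomial c 1 := by
      rw [monomial_eq, Finsupp.prod_fintype _ _ (by simp)]
      simp
    rw [this]
    simp
  have hQdeg : Q.totalDegree ≤ c.degree :=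
    (totalDegree_prod_sub_C_le T _ _ hL).trans_eq hcard
  have hQeval : ∀ x, eval x Q = ∏ i, ∏ a ∈ (S i).erase (s i), (x i - a) := fun x => by
    simp [hQ, hT, prod_sigma, map_prod]
  have hQs : eval s Q ≠ 0 := by
    rw [hQeval]
    refine prod_ne_zero_iff.2 fun i _ => prod_ne_zero_iff.2 fun a ha => ?_
    exact sub_ne_zero.2 (ne_of_mem_erase ha).symm
  have hQx : ∀ x : ι → F, (∀ i, x i ∈ S i) → x ≠ s → eval x Q = 0 := by
    intro x hx hne
    obtain ⟨i, hi⟩ := Function.ne_iff.1 hne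
    rw [hQeval]
    exact prod_eq_zero (mem_univ i) (prod_eq_zero (mem_erase.2 ⟨hi, hx i⟩) (sub_self _))
  set R : MvPolynomial ι F := P - C (eval s P / eval s Q) * Q with hR
  have hRc : coeff c R ≠ 0 := by
    rw [hR, coeff_sub, coeff_C_mul, hP, hQc]
    simpa using ⟨hPs, hQs⟩
  have hRdeg : R.totalDegree = c.degree := by
    refine le_antisymm ((totalDegree_sub _ _).trans (max_le hdeg ?_)) ?_
    · refine (totalDegree_mul _ _).trans ?_
      simpa using hQdeg
    · by_contra! h
      exact hRc (coeff_eq_zero_of_totalDegree_lt_degree h)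
  obtain ⟨x, hx, hxR⟩ := combinatorial_nullstellensatz_exists_eval_nonzero R c hRc hRdeg S
    fun i => by rw [hS]; exact Nat.lt_succ_self _
  apply hxR
  by_cases hxs : x = s
  · subst hxs
    simp [hR, div_mul_cancel₀ _ hQs]
  · have hPx : eval x P = 0 := by
      by_contra h
      exact hxs (huniq x hx h)
    simp [hR, hPx, hQx x hx hxs]

end Coefficient

section SignedGrid

variable {F : Type*} [Field F] {d : ℕ}

/-- The polynomial `∏_{i < j} (X i - X j)`, with the factor replaced by `X i ^ 2 - X j ^ 2` when
`i` or `j` lies in `J`. -/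
noncomputable def signedVandermonde (F : Type*) [Field F] {d : ℕ} (J : Finset (Fin d)) :
    MvPolynomial (Fin d) F :=
  ∏ i, ∏ j ∈ Ioi i, if i ∈ J ∨ j ∈ J then X i ^ 2 - X j ^ 2 else X i - X j

/-- The `i`-th side of the grid: values of `u`, together with some values of `-u` if `i ∈ J`. -/
def signedGrid [DecidableEq F] (J : Finset (Fin d)) (u : Fin d → F) (i : Fin d) : Finset F :=
  if i ∈ J then univ.image u ∪ (Iic i).image fun j => -u j else (Iic i ∪ J).image u

/-- The top exponents of the grid `signedGrid J u`. -/
noncomputable def signedExponent (J : Finset (Fin d)) : Fin d →₀ ℕ :=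
  Finsupp.equivFunOnFinite.symm fun i =>
    i + #{j ∈ Ioi i | i ∈ J ∨ j ∈ J} + if i ∈ J then (i : ℕ) + 1 else 0

theorem card_signedGrid [DecidableEq F] (J : Finset (Fin d)) (u : Fin d → F)
    (hu : Function.Injective u) (hneg : ∀ j k, u j ≠ -u k) (i : Fin d) :
    #(signedGrid J u i) = signedExponent J i + 1 := by
  simp only [signedGrid, signedExponent, Finsupp.equivFunOnFinite_symm_apply_apply]
  split_ifs with hi
  · rw [card_union_of_disjoint, card_image_of_injective _ hu,
      card_image_of_injective _ (f := fun j => -u j) (neg_injective.comp hu)]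
    · simp [hi]
      omega
    · rw [disjoint_left]
      simp only [mem_image, not_exists, not_and]
      rintro _ ⟨j, _, rfl⟩ k _ h
      exact hneg j k h.symm
  · have : Iic i ∪ J = Iic i ∪ {j ∈ Ioi i | i ∈ J ∨ j ∈ J} := by
      ext j
      simp only [mem_union, mem_Iic, mem_filter, mem_Ioi, hi, false_or]
      have := lt_or_ge i j
      tauto
    rw [card_image_of_injective _ hu, this, card_union_of_disjoint]
    · simp
      omega
    · rw [disjoint_left]
      simp only [mem_Iic, mem_filter, mem_Ioi]
      intro j h1 h2
      exact absurd h2.1 (not_lt.2 h1)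

theorem mem_signedGrid [DecidableEq F] {J : Finset (Fin d)} {u : Fin d → F} {i : Fin d} {x : F} :
    x ∈ signedGrid J u i ↔
      ∃ j, (x = u j ∧ (i ∈ J ∨ j ≤ i ∨ j ∈ J)) ∨ (x = -u j ∧ i ∈ J ∧ j ≤ i) := by
  unfold signedGrid
  split_ifs with hi
  · simp only [mem_union, mem_image, mem_univ, true_and, mem_Iic, hi, true_or, and_true]
    constructor
    · rintro (⟨j, rfl⟩ | ⟨j, h, rfl⟩)
      exacts [⟨j, .inl rfl⟩, ⟨j, .inr ⟨rfl, h⟩⟩]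
    · rintro ⟨j, rfl | ⟨rfl, h⟩⟩
      exacts [.inl ⟨j, rfl⟩, .inr ⟨j, h, rfl⟩]
  · simp only [mem_image, mem_union, mem_Iic, hi, false_or, false_and, and_false, or_false]
    exact exists_congr fun j => by rw [and_comm, eq_comm]

theorem totalDegree_signedVandermonde_add_le (J : Finset (Fin d)) :
    ∑ i ∈ J, ((i : ℕ) + 1) + (signedVandermonde F J).totalDegree ≤ (signedExponent J).degree := by
  have hfac : ∀ i j : Fin d, (if i ∈ J ∨ j ∈ J then X i ^ 2 - X j ^ 2 else X i - X j :
      MvPolynomial (Fin d) F).totalDegree ≤ 1 + if i ∈ J ∨ j ∈ J then 1 else 0 := by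
    intro i j
    split_ifs
    · exact (totalDegree_sub _ _).trans (by simp)
    · exact (totalDegree_sub _ _).trans (by simp)
  have hV : (signedVandermonde F J).totalDegree ≤
      ∑ i, ∑ j ∈ Ioi i, (1 + if i ∈ J ∨ j ∈ J then 1 else 0) := by
    refine (totalDegree_finsetProd _ _).trans (sum_le_sum fun i _ => ?_)
    exact (totalDegree_finsetProd _ _).trans (sum_le_sum fun j _ => hfac i j)
  have hswap : ∑ i : Fin d, ∑ _j ∈ Ioi i, 1 = ∑ i : Fin d, (i : ℕ) := by
    rw [sum_comm' (t' := univ) (s' := fun j => Iio j) (by simp)]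
    simp
  simp only [sum_add_distrib, hswap] at hV
  have hE : (signedExponent J).degree = ∑ i : Fin d, (i : ℕ) +
      ∑ i : Fin d, ∑ j ∈ Ioi i, (if i ∈ J ∨ j ∈ J then 1 else 0) + ∑ i ∈ J, ((i : ℕ) + 1) := by
    simp only [Finsupp.degree_eq_sum, signedExponent, Finsupp.equivFunOnFinite_symm_apply_apply,
      sum_add_distrib, card_filter]
    simp only [sum_add_distrib, sum_ite_mem, univ_inter]
  omega

theorem eval_signedVandermonde_ne_zero {J : Finset (Fin d)} {x : Fin d → F} :
    eval x (signedVandermonde F J) ≠ 0 ↔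
      ∀ i j, i < j → (i ∈ J ∨ j ∈ J → x i ^ 2 ≠ x j ^ 2) ∧ x i ≠ x j := by
  simp only [signedVandermonde, map_prod, prod_ne_zero_iff, mem_univ, true_implies, mem_Ioi]
  refine forall_congr' fun i => forall_congr' fun j => forall_congr' fun _ => ?_
  split_ifs with h
  · simp only [map_sub, map_pow, eval_X, sub_ne_zero, h, true_implies]
    exact ⟨fun h' => ⟨h', fun h'' => h' (by rw [h''])⟩, fun h' => h'.1⟩
  · simp [sub_ne_zero, h]

/-- A point of the grid at which `signedVandermonde` does not vanish is a signed permutation. -/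
theorem exists_perm_of_mem_signedGrid [DecidableEq F] {J : Finset (Fin d)} {u x : Fin d → F}
    (hx : ∀ i, x i ∈ signedGrid J u i) (hV : eval x (signedVandermonde F J) ≠ 0) :
    ∃ σ : Equiv.Perm (Fin d), ∃ K ⊆ J, (∀ i ∈ K, σ i ≤ i) ∧
      (∀ i ∉ J, σ i ≤ i ∨ σ i ∈ J) ∧ ∀ i, x i = if i ∈ K then -u (σ i) else u (σ i) := by
  rw [eval_signedVandermonde_ne_zero] at hV
  choose f hf using fun i => mem_signedGrid.1 (hx i)
  have hsq : ∀ i, x i ^ 2 = u (f i) ^ 2 := fun i => by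
    rcases hf i with h | h <;> simp [h.1]
  have hfne : ∀ i j, i < j → f i ≠ f j := by
    intro i j hij h
    obtain ⟨h1, h2⟩ := hV i j hij
    by_cases hJ : i ∈ J ∨ j ∈ J
    · exact h1 hJ (by rw [hsq, hsq, h])
    · rw [not_or] at hJ
      rcases hf i with hi | hi
      · rcases hf j with hj | hj
        · exact h2 (by rw [hi.1, hj.1, h])
        · exact hJ.2 hj.2.1
      · exact hJ.1 hi.2.1
  have hinj : Function.Injective f := by
    intro i j h
    by_contra hne
    rcases lt_or_gt_of_ne hne with hlt | hlt
    · exact hfne i j hlt h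
    · exact hfne j i hlt h.symm
  refine ⟨Equiv.ofBijective f (Finite.injective_iff_bijective.1 hinj),
    {i ∈ J | x i = -u (f i) ∧ f i ≤ i}, filter_subset _ _, ?_, ?_, ?_⟩
  · intro i hi
    exact (mem_filter.1 hi).2.2
  · intro i hi
    rcases hf i with h | h
    · exact h.2.resolve_left hi
    · exact absurd h.2.1 hi
  · intro i
    simp only [mem_filter, Equiv.ofBijective_apply]
    split_ifs with h
    · exact h.2.1
    · rcases hf i with h' | h'
      · exact h'.1
      · exact absurd ⟨h'.2.1, h'.1, h'.2.2⟩ h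

theorem sum_ite_neg_eq {u : Fin d → F} (σ : Equiv.Perm (Fin d)) (K : Finset (Fin d)) :
    ∑ i, (if i ∈ K then -u (σ i) else u (σ i)) = ∑ i, u i - 2 * ∑ i ∈ K, u (σ i) := by
  have h : ∀ i, (if i ∈ K then -u (σ i) else u (σ i)) =
      u (σ i) - if i ∈ K then 2 * u (σ i) else 0 := fun i => by
    split_ifs <;> ring
  simp only [h, sum_sub_distrib, sum_ite_mem, univ_inter, mul_sum, Equiv.sum_comp σ u]

end SignedGrid

theorem Equiv.Perm.eq_one_of_forall_le {d : ℕ} (σ : Equiv.Perm (Fin d)) (h : ∀ i, σ i ≤ i) :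
    σ = 1 := by
  have hsum : ∑ i, (σ i : ℕ) = ∑ i : Fin d, (i : ℕ) := Equiv.sum_comp σ fun i => (i : ℕ)
  have := (sum_eq_sum_iff_of_le fun i _ => Fin.le_def.1 (h i)).1 hsum
  ext i
  simpa using this i (mem_univ i)

theorem totalDegree_sum_X_le {F : Type*} [Field F] (d : ℕ) :
    (∑ i, X i : MvPolynomial (Fin d) F).totalDegree ≤ 1 :=
  totalDegree_finsetSum_le fun i _ => by simp

section ZMod

variable {p : ℕ} [Fact p.Prime] {d : ℕ}

/-- Evaluated on the grid of the arithmetic progression `1, …, d`. -/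
theorem coeff_sum_X_pow_mul_signedVandermonde_ne_zero (hd : 2 * d < p) (J : Finset (Fin d))
    (hJ : ∑ i ∈ J, ((i : ℕ) + 1) < p) :
    coeff (signedExponent J) ((∑ i, X i) ^ (∑ i ∈ J, ((i : ℕ) + 1)) *
      signedVandermonde (ZMod p) J) ≠ 0 := by
  set N := ∑ i ∈ J, ((i : ℕ) + 1) with hN
  rcases Nat.eq_zero_or_pos d with rfl | hdpos
  · have : J = ∅ := Subsingleton.elim _ _
    subst this
    have h0 : signedExponent (∅ : Finset (Fin 0)) = 0 := Subsingleton.elim _ _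
    simp [hN, signedVandermonde, h0]
  have hp2 : (2 : ZMod p) ≠ 0 := by
    intro h
    have : ((2 : ℕ) : ZMod p) = 0 := by exact_mod_cast h
    rw [ZMod.natCast_eq_zero_iff] at this
    have := Nat.le_of_dvd two_pos this
    omega
  have hcast : ∀ {a b : ℕ}, a < p → b < p → (a : ZMod p) = b → a = b := by
    intro a b ha hb h
    rwa [ZMod.natCast_eq_natCast_iff', Nat.mod_eq_of_lt ha, Nat.mod_eq_of_lt hb] at h
  set u : Fin d → ZMod p := fun j => ((j + 1 : ℕ) : ZMod p) with hu
  have huinj : Function.Injective u := by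
    intro i j h
    have := hcast (by omega) (by omega) h
    ext
    omega
  have huneg : ∀ j k, u j ≠ -u k := by
    intro j k h
    have h' : (((j + 1) + (k + 1) : ℕ) : ZMod p) = (0 : ℕ) := by
      rw [eq_neg_iff_add_eq_zero] at h
      simpa [hu] using h
    have := hcast (by omega) (by omega) h'
    omega
  have husum : ∀ (K : Finset (Fin d)) (f : Fin d → Fin d),
      ∑ i ∈ K, u (f i) = ((∑ i ∈ K, ((f i : ℕ) + 1) : ℕ) : ZMod p) := fun K f => by simp [hu]
  set e : ℕ → ZMod p := fun k => ∑ i, u i - 2 * k with he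
  have hL : ∀ k ∈ range N, (∑ i, X i : MvPolynomial (Fin d) (ZMod p)).totalDegree ≤ 1 :=
    fun _ _ => totalDegree_sum_X_le d
  have hdeg := totalDegree_signedVandermonde_add_le (F := ZMod p) J
  have hcoeff := coeff_prod_sub_C_mul (signedExponent J) (range N)
    (fun _ => (∑ i, X i : MvPolynomial (Fin d) (ZMod p))) e hL (signedVandermonde (ZMod p) J)
    (by simpa using hdeg)
  rw [prod_const, card_range] at hcoeff
  rw [← hcoeff]
  set s : Fin d → ZMod p := fun i => if i ∈ J then -u i else u i with hs
  have heval : ∀ x : Fin d → ZMod p,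
      eval x ((∏ k ∈ range N, (∑ i, X i - C (e k))) * signedVandermonde (ZMod p) J) =
      (∏ k ∈ range N, (∑ i, x i - e k)) * eval x (signedVandermonde (ZMod p) J) := by
    intro x
    simp [map_prod]
  refine coeff_ne_zero_of_unique_eval_ne_zero _ _ ?_ (signedGrid J u)
    (card_signedGrid J u huinj huneg) s ?_ ?_ ?_
  · refine (totalDegree_mul _ _).trans ?_
    have := totalDegree_prod_sub_C_le (range N) _ e hL
    rw [card_range] at this
    omega
  · intro i
    rw [mem_signedGrid]
    by_cases hi : i ∈ J
    · exact ⟨i, .inr ⟨by simp [hs, hi], hi, le_rfl⟩⟩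
    · exact ⟨i, .inl ⟨by simp [hs, hi], .inr (.inl le_rfl)⟩⟩
  · rw [heval]
    refine mul_ne_zero (prod_ne_zero_iff.2 fun k hk => ?_) ?_
    · have hk := mem_range.1 hk
      have hsum := sum_ite_neg_eq (u := u) 1 J
      simp only [Equiv.Perm.one_apply] at hsum
      have husumJ := husum J id
      simp only [id_eq, ← hN] at husumJ
      simp only [hs, he]
      rw [hsum, husumJ]
      intro h
      have h2 : (2 : ZMod p) * (k - N) = 0 := by linear_combination h
      have h3 := (mul_eq_zero.1 h2).resolve_left hp2
      have := hcast (by omega) hJ (sub_eq_zero.1 h3)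
      omega
    · rw [eval_signedVandermonde_ne_zero]
      intro i j hij
      have h1 : u i ≠ u j := huinj.ne hij.ne
      have h2 := huneg i j
      have h3 : s i ≠ s j := by
        simp only [hs]
        split_ifs
        · exact neg_injective.ne h1
        · exact fun h => huneg j i h.symm
        · exact h2
        · exact h1
      refine ⟨fun _ h => ?_, h3⟩
      have hsq : ∀ i, s i ^ 2 = u i ^ 2 := fun i => by
        simp only [hs]
        split_ifs <;> simp
      rw [hsq, hsq, sq_eq_sq_iff_eq_or_eq_neg] at h
      exact h.elim h1 h2
  · intro x hx hPx
    rw [heval] at hPx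
    obtain ⟨σ, K, hKJ, hK, hJc, hxσ⟩ := exists_perm_of_mem_signedGrid hx (right_ne_zero_of_mul hPx)
    have hprod := left_ne_zero_of_mul hPx
    have hle1 : ∑ i ∈ K, ((σ i : ℕ) + 1) ≤ ∑ i ∈ K, ((i : ℕ) + 1) :=
      sum_le_sum fun i hi => Nat.succ_le_succ (Fin.le_def.1 (hK i hi))
    have hle2 : ∑ i ∈ K, ((i : ℕ) + 1) ≤ N := sum_le_sum_of_subset hKJ
    have hge : N ≤ ∑ i ∈ K, ((σ i : ℕ) + 1) := by
      by_contra! hlt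
      refine prod_ne_zero_iff.1 hprod _ (mem_range.2 hlt) ?_
      simp only [hxσ, he]
      rw [sum_ite_neg_eq, husum K σ, sub_self]
    have hKeq : K = J := by
      by_contra hne
      obtain ⟨i, hiJ, hiK⟩ := exists_of_ssubset (hKJ.ssubset_of_ne hne)
      have := sum_lt_sum_of_subset hKJ hiJ hiK (f := fun i : Fin d => (i : ℕ) + 1)
        (Nat.succ_pos _) (fun _ _ _ => Nat.zero_le _)
      omega
    have hfix : ∀ i ∈ K, σ i = i := by
      have := (sum_eq_sum_iff_of_le (f := fun i => (σ i : ℕ) + 1) (g := fun i => (i : ℕ) + 1)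
        fun i hi => Nat.succ_le_succ (Fin.le_def.1 (hK i hi))).1 (by omega)
      intro i hi
      ext
      have := this i hi
      omega
    have hσ : σ = 1 := by
      refine σ.eq_one_of_forall_le fun i => ?_
      by_cases hi : i ∈ J
      · exact hK i (hKeq ▸ hi)
      · refine (hJc i hi).resolve_right fun h => hi ?_
        have := σ.injective (hfix _ (hKeq ▸ h))
        rwa [this] at h
    funext i
    rw [hxσ, hσ, hKeq]
    simp [hs]

theorem sum_lt_card_sigmaLe (A : Finset (ZMod p)) (hA : ∀ a ∈ A, -a ∉ A) (α : ℕ)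
    (J : Finset (Fin #A)) (hJcard : #J ≤ #A - α) (hJ : ∑ i ∈ J, ((i : ℕ) + 1) < p) :
    ∑ i ∈ J, ((i : ℕ) + 1) < #(SigmaLe A α) := by
  by_contra! hcard
  set N := ∑ i ∈ J, ((i : ℕ) + 1)
  have h0 : (0 : ZMod p) ∉ A := fun h => hA 0 h (by simpa using h)
  have hd : 2 * #A < p := by
    have hdisj : Disjoint A (A.image Neg.neg) := by
      rw [disjoint_left]
      rintro a ha h
      obtain ⟨b, hb, rfl⟩ := mem_image.1 h
      exact hA b hb ha
    have hsub : A ∪ A.image Neg.neg ⊆ univ.erase 0 := by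
      intro a ha
      rw [mem_erase]
      refine ⟨?_, mem_univ _⟩
      rintro rfl
      rcases mem_union.1 ha with h | h
      · exact h0 h
      · obtain ⟨b, hb, hb0⟩ := mem_image.1 h
        exact h0 (neg_eq_zero.1 hb0 ▸ hb)
    have h := card_le_card hsub
    rw [card_union_of_disjoint hdisj, card_image_of_injective _ neg_injective,
      card_erase_of_mem (mem_univ _), card_univ, ZMod.card] at h
    have := (Fact.out : p.Prime).pos
    omega
  set u : Fin #A → ZMod p := fun i => A.equivFin.symm i
  have huA : ∀ i, u i ∈ A := fun i => (A.equivFin.symm i).2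
  have huinj : Function.Injective u := Subtype.val_injective.comp A.equivFin.symm.injective
  have huneg : ∀ j k, u j ≠ -u k := fun j k h => hA _ (huA k) (h ▸ huA j)
  set B : Finset (ZMod p) := (SigmaLe A α).image fun b => ∑ i, u i - 2 * b
  obtain ⟨E, hBE, -, hE⟩ := exists_subsuperset_card_eq (subset_univ B)
    (card_image_le.trans hcard) (by rw [card_univ, ZMod.card]; exact hJ.le)
  have hL : ∀ k ∈ E, (∑ i, X i : MvPolynomial (Fin #A) (ZMod p)).totalDegree ≤ 1 :=
    fun _ _ => totalDegree_sum_X_le _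
  have hdeg := totalDegree_signedVandermonde_add_le (F := ZMod p) J
  have hcoeff := coeff_prod_sub_C_mul (signedExponent J) E
    (fun _ => (∑ i, X i : MvPolynomial (Fin #A) (ZMod p))) id hL (signedVandermonde (ZMod p) J)
    (by rw [hE]; exact hdeg)
  rw [prod_const, hE] at hcoeff
  have hne := hcoeff ▸ coeff_sum_X_pow_mul_signedVandermonde_ne_zero hd J hJ
  obtain ⟨x, hx, hPx⟩ := combinatorial_nullstellensatz_exists_eval_nonzero _ _ hne
    (le_antisymm (by
      refine (totalDegree_mul _ _).trans ?_
      have := totalDegree_prod_sub_C_le E _ id hL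
      omega) (not_lt.1 fun h => hne (coeff_eq_zero_of_totalDegree_lt_degree h)))
    (signedGrid J u) fun i => by rw [card_signedGrid J u huinj huneg]; exact Nat.lt_succ_self _
  rw [map_mul] at hPx
  obtain ⟨σ, K, hKJ, -, -, hxσ⟩ := exists_perm_of_mem_signedGrid hx (right_ne_zero_of_mul hPx)
  apply left_ne_zero_of_mul hPx
  rw [map_prod]
  refine prod_eq_zero (i := ∑ i, x i) (hBE (mem_image.2 ⟨∑ i ∈ K, u (σ i), ?_, ?_⟩)) ?_
  · have hinj : Function.Injective fun i => u (σ i) := huinj.comp σ.injective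
    refine mem_image.2 ⟨K.image fun i => u (σ i), mem_filter.2 ⟨mem_powerset.2 ?_, ?_⟩, ?_⟩
    · exact image_subset_iff.2 fun i _ => huA _
    · exact card_image_le.trans ((card_le_card hKJ).trans hJcard)
    · rw [sum_image hinj.injOn]
      rfl
  · simp only [hxσ]
    rw [sum_ite_neg_eq]
  · simp

end ZMod

theorem exists_sum_eq_of_le (α k n : ℕ)
    (hn : n + α * (α + 1) / 2 ≤ (α + k) * (α + k + 1) / 2) :
    ∃ J : Finset (Fin (α + k)), #J ≤ k ∧ ∑ i ∈ J, ((i : ℕ) + 1) = n := by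
  induction k generalizing n with
  | zero => exact ⟨∅, by simp, by simp at hn ⊢; omega⟩
  | succ k ih =>
    rcases Nat.eq_zero_or_pos n with rfl | hpos
    · exact ⟨∅, by simp, by simp⟩
    by_cases hlt : n < α + (k + 1)
    · exact ⟨{⟨n - 1, by omega⟩}, by simp, by simp; omega⟩
    · have hstep : (α + (k + 1)) * (α + (k + 1) + 1) / 2 =
          (α + k) * (α + k + 1) / 2 + (α + k + 1) := by
        rw [show (α + (k + 1)) * (α + (k + 1) + 1) =
          (α + k) * (α + k + 1) + (α + k + 1) * 2 by ring, Nat.add_mul_div_right _ _ two_pos]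
      obtain ⟨J, hJ, hsum⟩ := ih (n - (α + k + 1)) (by omega)
      refine ⟨insert (Fin.last (α + k)) (J.map Fin.castSuccEmb), ?_, ?_⟩
      · refine (card_insert_le _ _).trans ?_
        simpa using hJ
      · rw [sum_insert (by simp [Fin.castSucc_ne_last])]
        have hsum' : ∑ i ∈ J.map Fin.castSuccEmb, ((i : ℕ) + 1) = n - (α + k + 1) := by
          rw [sum_map, ← hsum]
          rfl
        rw [← Nat.add_assoc α k 1] at hlt
        refine (congrArg _ hsum').trans ?_
        simp only [Fin.val_last]
        omega

theorem sigma_le_card_bound (p : ℕ) (hp : p.Prime) (A : Finset (ZMod p))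
    (hA : ∀ a ∈ A, -a ∉ A) (α : ℕ) (hα : α ≤ A.card) :
    min p (A.card * (A.card + 1) / 2 - α * (α + 1) / 2 + 1) ≤ (SigmaLe A α).card := by
  have := Fact.mk hp
  obtain ⟨k, hk⟩ := Nat.exists_eq_add_of_le hα
  have hmono : α * (α + 1) / 2 ≤ #A * (#A + 1) / 2 :=
    Nat.div_le_div_right (Nat.mul_le_mul hα (by omega))
  have hpos := hp.pos
  obtain ⟨J, hJ, hsum⟩ : ∃ J : Finset (Fin #A), #J ≤ k ∧ ∑ i ∈ J, ((i : ℕ) + 1) =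
      min (p - 1) (#A * (#A + 1) / 2 - α * (α + 1) / 2) := by
    have := exists_sum_eq_of_le α k (min (p - 1) (#A * (#A + 1) / 2 - α * (α + 1) / 2))
      (by rw [← hk]; omega)
    rwa [← hk] at this
  have := sum_lt_card_sigmaLe A hA α J (by omega) (by omega)
  omega
end
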